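/- Let A = (a_{ij}) be an r×n matrix with entries in {0,1} and no zero row, and set l_i(x) = Σ_{j=1}^n a_{ij} x_j. Suppose that after some permutation of the rows of A, in every column the entries equal to 1 occur in consecutive rows. If the series ζ(A) = Σ_{x ∈ (ℤ_{>0})ⁿ} 1/(l₁(x)⋯l_r(x)) converges, then ζ(A) ∈ 𝒜. -/

import Mathlib

open Finset

/-- The multiple zeta value `ζ(k₁,…,k_r) = Σ_{0<v₁<⋯<v_r} v₁^{−k₁}⋯v_r^{−k_r}`. -/
noncomputable def mzv {r : ℕ} (k : Fin r → ℕ) : ℝ :=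
  ∑' v : {v : Fin r → ℕ // (∀ i, 0 < v i) ∧ StrictMono v},
    ∏ i, (1 : ℝ) / (v.1 i : ℝ) ^ (k i)

/-- `x` is a multiple zeta value (convergent: `k_r ≥ 2`, all entries `≥ 1`). -/
def IsMZV (x : ℝ) : Prop :=
  ∃ (r : ℕ) (k : Fin (r + 1) → ℕ),
    (∀ i, 1 ≤ k i) ∧ 2 ≤ k (Fin.last r) ∧ x = mzv k

/-! ### Partial sums and algebras closed under summation -/

/-- The partial sum `∑_{0 < m < n} f m`. -/
noncomputable def psum (f : ℕ → ℝ) (n : ℕ) : ℝ := ∑ m ∈ Ico 1 n, f m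

@[simp] lemma psum_zero (f : ℕ → ℝ) : psum f 0 = 0 := by simp [psum]

@[simp] lemma psum_one (f : ℕ → ℝ) : psum f 1 = 0 := by simp [psum]

lemma psum_succ (f : ℕ → ℝ) {n : ℕ} (hn : 0 < n) : psum f (n + 1) = psum f n + f n := by
  simp [psum, Finset.sum_Ico_succ_top (Nat.succ_le_of_lt hn)]

lemma psum_succ_left (f : ℕ → ℝ) {n : ℕ} (hn : 0 < n) :
    psum f (n + 1) = f 1 + psum (fun m => f (m + 1)) n := by
  induction n, hn using Nat.le_induction with
  | base => simp [psum_succ]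
  | succ n hn ih =>
    rw [psum_succ f (Nat.succ_pos n), ih, psum_succ (fun m => f (m + 1)) hn]
    ring

lemma psum_congr {f g : ℕ → ℝ} {n : ℕ} (h : ∀ m, 0 < m → m < n → f m = g m) :
    psum f n = psum g n :=
  Finset.sum_congr rfl fun m hm => h m (Finset.mem_Ico.1 hm).1 (Finset.mem_Ico.1 hm).2

lemma psum_add (f g : ℕ → ℝ) (n : ℕ) : psum (fun m => f m + g m) n = psum f n + psum g n :=
  Finset.sum_add_distrib

lemma psum_sub (f g : ℕ → ℝ) (n : ℕ) : psum (fun m => f m - g m) n = psum f n - psum g n :=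
  Finset.sum_sub_distrib _ _

lemma psum_mul_left (c : ℝ) (f : ℕ → ℝ) (n : ℕ) :
    psum (fun m => c * f m) n = c * psum f n :=
  (Finset.mul_sum _ _ _).symm

/-- The quasi-shuffle product of two partial sums. -/
lemma psum_mul_psum (f g : ℕ → ℝ) (n : ℕ) :
    psum f n * psum g n = psum (fun m => f m * psum g m) n + psum (fun m => g m * psum f m) n
      + psum (fun m => f m * g m) n := by
  induction n with
  | zero => simp
  | succ n ih =>
    rcases Nat.eq_zero_or_pos n with rfl | hn
    · simp
    · simp only [psum_succ _ hn]
      linear_combination ih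

/-- Summation over the last variable. -/
noncomputable def ssum {X : Type} (f : X × ℕ → ℝ) (p : X × ℕ) : ℝ :=
  psum (fun m => f (p.1, m)) p.2

/-- Functions obtained from those in `Q` by addition, multiplication by elements of `Q` and
summation over the last variable. -/
inductive SumClosure {X : Type} (Q : Subalgebra ℚ (X × ℕ → ℝ)) : (X × ℕ → ℝ) → Prop
  | base {q} (hq : q ∈ Q) : SumClosure Q q
  | add {f g} (hf : SumClosure Q f) (hg : SumClosure Q g) : SumClosure Q (f + g)
  | mul {q f} (hq : q ∈ Q) (hf : SumClosure Q f) : SumClosure Q (q * f)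
  | sum {f} (hf : SumClosure Q f) : SumClosure Q (ssum f)

lemma SumClosure.mul_mem {X : Type} {Q : Subalgebra ℚ (X × ℕ → ℝ)} {f g : X × ℕ → ℝ}
    (hf : SumClosure Q f) (hg : SumClosure Q g) : SumClosure Q (f * g) := by
  induction hf generalizing g with
  | base hq => exact .mul hq hg
  | add _ _ ih₁ ih₂ => rw [add_mul]; exact .add (ih₁ hg) (ih₂ hg)
  | mul hq _ ih => rw [mul_assoc]; exact .mul hq (ih hg)
  | @sum f hf ih =>
    induction hg with
    | base hq => rw [mul_comm]; exact .mul hq (.sum hf)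
    | add _ _ ih₁ ih₂ => rw [mul_add]; exact .add ih₁ ih₂
    | mul hq _ ih => rw [mul_left_comm]; exact .mul hq ih
    | @sum g hg ihg =>
      have : ssum f * ssum g = ssum (f * ssum g) + ssum (ssum f * g) + ssum (f * g) := by
        funext p
        simp only [Pi.mul_apply, Pi.add_apply, ssum, psum_mul_psum]
        simp only [mul_comm]
      rw [this]
      exact .add (.add (.sum (ih (.sum hg))) (.sum ihg)) (.sum (ih hg))

/-- `SumClosure Q` as a subalgebra. -/
def sumAlg {X : Type} (Q : Subalgebra ℚ (X × ℕ → ℝ)) : Subalgebra ℚ (X × ℕ → ℝ) where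
  carrier := {f | SumClosure Q f}
  mul_mem' := SumClosure.mul_mem
  add_mem' := .add
  algebraMap_mem' c := .base (Q.algebraMap_mem c)

lemma le_sumAlg {X : Type} (Q : Subalgebra ℚ (X × ℕ → ℝ)) : Q ≤ sumAlg Q :=
  fun _ hq => SumClosure.base hq

lemma ssum_mem_sumAlg {X : Type} {Q : Subalgebra ℚ (X × ℕ → ℝ)} {f : X × ℕ → ℝ}
    (hf : f ∈ sumAlg Q) : ssum f ∈ sumAlg Q :=
  SumClosure.sum hf

/-- Sums of products of a function of `(x, b)` and a function of `(x, n)`. -/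
def splitFun {X : Type} (Q : Subalgebra ℚ (X × ℕ → ℝ)) : AddSubmonoid ((X × ℕ) × ℕ → ℝ) :=
  AddSubmonoid.closure {F | ∃ u ∈ Q, ∃ v ∈ Q, F = fun p => u p.1 * v (p.1.1, p.2)}

/-- The points `((x, b), n)` with `(x, b)` in the domain and `0 < n < b`. -/
def nextDom {X : Type} (D : X × ℕ → Prop) (p : (X × ℕ) × ℕ) : Prop :=
  D p.1 ∧ 0 < p.2 ∧ p.2 < p.1.2

/-- An algebra of functions which are determined by their restriction to a domain `D` and whose
divided differences in the last variable split. -/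
structure IsSplitting {X : Type} (D : X × ℕ → Prop) (Q : Subalgebra ℚ (X × ℕ → ℝ)) : Prop where
  down : ∀ {x b n}, D (x, b) → 0 < n → n < b → D (x, n)
  pos : ∀ {x b}, D (x, b) → 0 < b
  zero_mem : ∀ {f : X × ℕ → ℝ}, (∀ p, D p → f p = 0) → f ∈ Q
  divDiff : ∀ q ∈ Q, ∃ F ∈ splitFun Q, ∀ p, nextDom D p →
    q p.1 - q (p.1.1, p.2) = ((p.1.2 : ℝ) - p.2) * F p

/-- The algebra of coefficients one level higher. -/
noncomputable def nextAlg {X : Type} (D : X × ℕ → Prop) (Q : Subalgebra ℚ (X × ℕ → ℝ)) :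
    Subalgebra ℚ ((X × ℕ) × ℕ → ℝ) :=
  Algebra.adjoin ℚ ({f | ∃ k ∈ sumAlg Q, f = fun p => k p.1} ∪
    {f | ∃ q ∈ Q, f = fun p => q (p.1.1, p.2)} ∪ {fun p => ((p.1.2 : ℝ) - p.2)⁻¹} ∪
    {f | ∀ p, nextDom D p → f p = 0})

section NextAlg

variable {X : Type} {D : X × ℕ → Prop} {Q : Subalgebra ℚ (X × ℕ → ℝ)}

lemma coef_mem_nextAlg {k : X × ℕ → ℝ} (hk : k ∈ sumAlg Q) :
    (fun p => k p.1) ∈ nextAlg D Q :=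
  Algebra.subset_adjoin (.inl (.inl (.inl ⟨k, hk, rfl⟩)))

lemma last_mem_nextAlg {q : X × ℕ → ℝ} (hq : q ∈ Q) :
    (fun p => q (p.1.1, p.2)) ∈ nextAlg D Q :=
  Algebra.subset_adjoin (.inl (.inl (.inr ⟨q, hq, rfl⟩)))

lemma pole_mem_nextAlg : (fun p => ((p.1.2 : ℝ) - p.2)⁻¹) ∈ nextAlg D Q :=
  Algebra.subset_adjoin (.inl (.inr rfl))

lemma zero_mem_nextAlg {f : (X × ℕ) × ℕ → ℝ} (hf : ∀ p, nextDom D p → f p = 0) :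
    f ∈ nextAlg D Q :=
  Algebra.subset_adjoin (.inr hf)

lemma splitFun_mul_left {u : X × ℕ → ℝ} (hu : u ∈ Q) {F : (X × ℕ) × ℕ → ℝ}
    (hF : F ∈ splitFun Q) : (fun p => u p.1 * F p) ∈ splitFun Q := by
  induction hF using AddSubmonoid.closure_induction with
  | mem F hF =>
    obtain ⟨u', hu', v, hv, rfl⟩ := hF
    refine AddSubmonoid.subset_closure ⟨u * u', Q.mul_mem hu hu', v, hv, ?_⟩
    funext p; simp [mul_assoc]
  | zero =>
    convert (splitFun Q).zero_mem using 1
    funext p; simp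
  | add F G _ _ hF hG =>
    convert (splitFun Q).add_mem hF hG using 1
    funext p; simp [mul_add]

lemma splitFun_mul_right {v : X × ℕ → ℝ} (hv : v ∈ Q) {F : (X × ℕ) × ℕ → ℝ}
    (hF : F ∈ splitFun Q) : (fun p => v (p.1.1, p.2) * F p) ∈ splitFun Q := by
  induction hF using AddSubmonoid.closure_induction with
  | mem F hF =>
    obtain ⟨u, hu, v', hv', rfl⟩ := hF
    refine AddSubmonoid.subset_closure ⟨u, hu, v * v', Q.mul_mem hv hv', ?_⟩
    funext p; simp [mul_left_comm]
  | zero =>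
    convert (splitFun Q).zero_mem using 1
    funext p; simp
  | add F G _ _ hF hG =>
    convert (splitFun Q).add_mem hF hG using 1
    funext p; simp [mul_add]

/-- Splitting of divided differences only has to be checked on generators. -/
lemma divDiff_adjoin {S : Set (X × ℕ → ℝ)} (hS : ∀ q ∈ S, ∃ F ∈ splitFun (Algebra.adjoin ℚ S),
      ∀ p, nextDom D p → q p.1 - q (p.1.1, p.2) = ((p.1.2 : ℝ) - p.2) * F p)
    (q : X × ℕ → ℝ) (hq : q ∈ Algebra.adjoin ℚ S) :
    ∃ F ∈ splitFun (Algebra.adjoin ℚ S),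
      ∀ p, nextDom D p → q p.1 - q (p.1.1, p.2) = ((p.1.2 : ℝ) - p.2) * F p := by
  induction hq using Algebra.adjoin_induction with
  | mem q hq => exact hS q hq
  | algebraMap c => exact ⟨0, (splitFun _).zero_mem, fun p _ => by simp [Pi.algebraMap_apply]⟩
  | add q q' _ _ h h' =>
    obtain ⟨F, hF, h⟩ := h
    obtain ⟨F', hF', h'⟩ := h'
    refine ⟨F + F', (splitFun _).add_mem hF hF', fun p hp => ?_⟩
    simp only [Pi.add_apply]
    linear_combination h p hp + h' p hp
  | mul q q' hq hq' h h' =>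
    obtain ⟨F, hF, h⟩ := h
    obtain ⟨F', hF', h'⟩ := h'
    refine ⟨_, (splitFun _).add_mem (splitFun_mul_left hq hF') (splitFun_mul_right hq' hF),
      fun p hp => ?_⟩
    simp only [Pi.add_apply, Pi.mul_apply]
    linear_combination q p.1 * h' p hp + q' (p.1.1, p.2) * h p hp

lemma IsSplitting.congr (hQ : IsSplitting D Q) {f g : X × ℕ → ℝ} (hf : f ∈ sumAlg Q)
    (h : ∀ p, D p → f p = g p) : g ∈ sumAlg Q := by
  have : g = f + (g - f) := by ring
  rw [this]
  exact add_mem hf (le_sumAlg Q (hQ.zero_mem fun p hp => by simp [h p hp]))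

lemma IsSplitting.next (hQ : IsSplitting D Q) : IsSplitting (nextDom D) (nextAlg D Q) where
  down h hn hlt := ⟨h.1, hn, hlt.trans h.2.2⟩
  pos h := h.2.1
  zero_mem hf := zero_mem_nextAlg hf
  divDiff := by
    refine divDiff_adjoin ?_
    rintro q (((⟨k, hk, rfl⟩ | ⟨q, hq, rfl⟩) | rfl) | hq)
    · exact ⟨0, (splitFun _).zero_mem, fun p _ => by simp⟩
    · obtain ⟨F, hF, h⟩ := hQ.divDiff q hq
      refine ⟨fun p => F ((p.1.1.1, p.1.2), p.2), ?_, fun p hp => ?_⟩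
      · clear h
        induction hF using AddSubmonoid.closure_induction with
        | mem F hF =>
          obtain ⟨u, hu, v, hv, rfl⟩ := hF
          exact AddSubmonoid.subset_closure
            ⟨_, last_mem_nextAlg hu, _, last_mem_nextAlg hv, rfl⟩
        | zero => exact (splitFun _).zero_mem
        | add F G _ _ hF hG => exact (splitFun _).add_mem hF hG
      · exact h ((p.1.1.1, p.1.2), p.2)
          ⟨hQ.down hp.1.1 hp.1.2.1 hp.1.2.2, hp.2.1, hp.2.2⟩
    · refine ⟨_, AddSubmonoid.subset_closure
        ⟨_, pole_mem_nextAlg, _, pole_mem_nextAlg, rfl⟩, fun p hp => ?_⟩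
      obtain ⟨⟨_, _, h₁⟩, _, h₂⟩ := hp
      have h₁' : (p.1.2 : ℝ) < p.1.1.2 := by exact_mod_cast h₁
      have h₂' : (p.2 : ℝ) < p.1.2 := by exact_mod_cast h₂
      have e₁ : (p.1.1.2 : ℝ) - p.1.2 ≠ 0 := by linarith
      have e₂ : (p.1.1.2 : ℝ) - p.2 ≠ 0 := by linarith
      field_simp
      ring
    · refine ⟨0, (splitFun _).zero_mem, fun p hp => ?_⟩
      rw [hq p.1 hp.1, hq (p.1.1, p.2) ⟨hp.1.1, hp.2.1, hp.2.2.trans hp.1.2.2⟩]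
      simp

end NextAlg

/-! ### Evaluating a sum over the last variable at its top index -/

section Diagonal

variable {X : Type} {D : X × ℕ → Prop} {Q : Subalgebra ℚ (X × ℕ → ℝ)}

/-- The points `((x, b), n)` with `(x, b)` in the domain and `0 < n ≤ b`. -/
def closedDom (D : X × ℕ → Prop) (p : (X × ℕ) × ℕ) : Prop :=
  D p.1 ∧ 0 < p.2 ∧ p.2 ≤ p.1.2

lemma nextDom.closed {p : (X × ℕ) × ℕ} (hp : nextDom D p) : closedDom D p :=
  ⟨hp.1, hp.2.1, hp.2.2.le⟩

lemma ssum_add (F G : X × ℕ → ℝ) : ssum (F + G) = ssum F + ssum G := by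
  funext p
  exact psum_add _ _ _

lemma ssum_congr {F G : (X × ℕ) × ℕ → ℝ} (h : ∀ p, nextDom D p → F p = G p)
    {p : (X × ℕ) × ℕ} (hp : closedDom D p) : ssum F p = ssum G p :=
  psum_congr fun m hm hlt => h (p.1, m) ⟨hp.1, hm, hlt.trans_le hp.2.2⟩

/-- Iterated sums of depth less than `d`, with coefficients in `nextAlg D Q`. -/
inductive IterSum (D : X × ℕ → Prop) (Q : Subalgebra ℚ (X × ℕ → ℝ)) :
    ℕ → ((X × ℕ) × ℕ → ℝ) → Prop
  | zero (d) : IterSum D Q d 0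
  | coef {d k} (hk : k ∈ sumAlg Q) : IterSum D Q (d + 1) (fun p => k p.1)
  | add {d F G} (hF : IterSum D Q d F) (hG : IterSum D Q d G) : IterSum D Q d (F + G)
  | sum {d l H} (hl : l ∈ nextAlg D Q) (hH : IterSum D Q d H) : IterSum D Q (d + 1) (ssum (l * H))
  | congr {d F G} (hF : IterSum D Q d F) (h : ∀ p, closedDom D p → F p = G p) : IterSum D Q d G

namespace IterSum

lemma succ {d : ℕ} {F : (X × ℕ) × ℕ → ℝ} (hF : IterSum D Q d F) : IterSum D Q (d + 1) F := by
  induction hF with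
  | zero d => exact .zero _
  | coef hk => exact .coef hk
  | add _ _ h₁ h₂ => exact .add h₁ h₂
  | sum hl _ ih => exact .sum hl ih
  | congr _ h ih => exact .congr ih h

lemma mono {d e : ℕ} (hde : d ≤ e) {F : (X × ℕ) × ℕ → ℝ} (hF : IterSum D Q d F) :
    IterSum D Q e F := by
  induction e, hde using Nat.le_induction with
  | base => exact hF
  | succ e _ ih => exact ih.succ

lemma coef_mul {d : ℕ} {F : (X × ℕ) × ℕ → ℝ} {k : X × ℕ → ℝ} (hk : k ∈ sumAlg Q)
    (hF : IterSum D Q d F) : IterSum D Q d (fun p => k p.1 * F p) := by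
  induction hF with
  | zero d => exact .congr (.zero d) fun p _ => by simp
  | coef hk' => exact .coef (mul_mem hk hk')
  | add _ _ h₁ h₂ => exact .congr (.add h₁ h₂) fun p _ => by simp [mul_add]
  | @sum d l H hl hH ih =>
    refine .congr (.sum (mul_mem (coef_mem_nextAlg hk) hl) hH) fun p _ => ?_
    simp only [ssum, ← psum_mul_left, Pi.mul_apply, mul_assoc]
  | congr _ h ih => exact .congr ih fun p hp => by rw [h p hp]

lemma sub {d : ℕ} {F G : (X × ℕ) × ℕ → ℝ} (hF : IterSum D Q d F) (hG : IterSum D Q d G) :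
    IterSum D Q d (F - G) :=
  .congr (.add hF (coef_mul (neg_mem (one_mem _)) hG)) fun p _ => by
    simp [sub_eq_add_neg]

lemma eq_zero {F : (X × ℕ) × ℕ → ℝ} (hF : IterSum D Q 0 F) (p : (X × ℕ) × ℕ)
    (hp : closedDom D p) : F p = 0 := by
  generalize hd : 0 = d at hF
  induction hF with
  | zero d => rfl
  | coef hk => omega
  | add _ _ h₁ h₂ => simp [h₁ hd, h₂ hd]
  | sum hl _ ih => omega
  | congr _ h ih => rw [← h p hp, ih hd]

end IterSum

/-- Combinations of iterated sums of depth less than `d`. -/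
inductive IterTerm (D : X × ℕ → Prop) (Q : Subalgebra ℚ (X × ℕ → ℝ)) (d : ℕ) :
    ((X × ℕ) × ℕ → ℝ) → Prop
  | mk {l H} (hl : l ∈ nextAlg D Q) (hH : IterSum D Q d H) : IterTerm D Q d (l * H)
  | add {F G} (hF : IterTerm D Q d F) (hG : IterTerm D Q d G) : IterTerm D Q d (F + G)
  | congr {F G} (hF : IterTerm D Q d F) (h : ∀ p, nextDom D p → F p = G p) : IterTerm D Q d G

lemma IterSum.term {d : ℕ} {F : (X × ℕ) × ℕ → ℝ} (hF : IterSum D Q d F) : IterTerm D Q d F :=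
  .congr (.mk (one_mem _) hF) fun p _ => by simp

namespace IterTerm

lemma ssum {d : ℕ} {F : (X × ℕ) × ℕ → ℝ} (hF : IterTerm D Q d F) :
    IterSum D Q (d + 1) (ssum F) := by
  induction hF with
  | mk hl hH => exact .sum hl hH
  | add _ _ h₁ h₂ => rw [ssum_add]; exact .add h₁ h₂
  | congr _ h ih => exact .congr ih fun p hp => ssum_congr h hp

lemma mono {d e : ℕ} (hde : d ≤ e) {F : (X × ℕ) × ℕ → ℝ} (hF : IterTerm D Q d F) :
    IterTerm D Q e F := by
  induction hF with
  | mk hl hH => exact .mk hl (hH.mono hde)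
  | add _ _ h₁ h₂ => exact .add h₁ h₂
  | congr _ h ih => exact .congr ih h

lemma mul {d : ℕ} {l F : (X × ℕ) × ℕ → ℝ} (hl : l ∈ nextAlg D Q) (hF : IterTerm D Q d F) :
    IterTerm D Q d (l * F) := by
  induction hF with
  | mk hl' hH => rw [← mul_assoc]; exact .mk (mul_mem hl hl') hH
  | add _ _ h₁ h₂ => rw [mul_add]; exact .add h₁ h₂
  | congr _ h ih => exact .congr ih fun p hp => by simp [h p hp]

lemma sub {d : ℕ} {F G : (X × ℕ) × ℕ → ℝ} (hF : IterTerm D Q d F) (hG : IterTerm D Q d G) :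
    IterTerm D Q d (F - G) :=
  .congr (.add hF (mul (neg_mem (one_mem _)) hG)) fun p _ => by simp [sub_eq_add_neg]

end IterTerm

/-- The forward difference in the last variable lowers the depth. -/
lemma IterSum.fwd {d : ℕ} {G : (X × ℕ) × ℕ → ℝ} (hG : IterSum D Q (d + 1) G) :
    IterTerm D Q d (fun p => G (p.1, p.2 + 1) - G p) := by
  generalize he : d + 1 = e at hG
  induction hG with
  | zero e => exact .congr (IterSum.zero d).term fun p _ => by simp
  | coef hk => exact .congr (IterSum.zero d).term fun p _ => by simp
  | add _ _ h₁ h₂ =>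
    refine .congr (.add (h₁ he) (h₂ he)) fun p _ => ?_
    simp only [Pi.add_apply]; ring
  | @sum e l H hl hH ih =>
    obtain rfl : d = e := by omega
    refine .congr (.mk hl hH) fun p hp => ?_
    simp only [_root_.ssum, psum_succ _ hp.2.1]; ring
  | congr _ h ih =>
    refine .congr (ih he) fun p hp => ?_
    rw [h p hp.closed, h (p.1, p.2 + 1) ⟨hp.1, Nat.succ_pos _, hp.2.2⟩]

/-- Combinations, with coefficients depending on `(x, n)` only, of iterated sums. -/
inductive LastTerm (D : X × ℕ → Prop) (Q : Subalgebra ℚ (X × ℕ → ℝ)) (d : ℕ) :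
    ((X × ℕ) × ℕ → ℝ) → Prop
  | mk {q H} (hq : q ∈ Q) (hH : IterSum D Q d H) :
      LastTerm D Q d (fun p => q (p.1.1, p.2) * H p)
  | add {F G} (hF : LastTerm D Q d F) (hG : LastTerm D Q d G) : LastTerm D Q d (F + G)
  | congr {F G} (hF : LastTerm D Q d F) (h : ∀ p, closedDom D p → F p = G p) : LastTerm D Q d G

lemma IterSum.last {d : ℕ} {F : (X × ℕ) × ℕ → ℝ} (hF : IterSum D Q d F) : LastTerm D Q d F :=
  .congr (.mk (one_mem _) hF) fun p _ => by simp

lemma LastTerm.term {d : ℕ} {F : (X × ℕ) × ℕ → ℝ} (hF : LastTerm D Q d F) :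
    IterTerm D Q d F := by
  induction hF with
  | mk hq hH => exact .mk (last_mem_nextAlg hq) hH
  | add _ _ h₁ h₂ => exact .add h₁ h₂
  | congr _ h ih => exact .congr ih fun p hp => h p hp.closed

/-- Iterated sums whose increment along the diagonal direction is controlled. -/
structure Steady (D : X × ℕ → Prop) (Q : Subalgebra ℚ (X × ℕ → ℝ)) (d : ℕ)
    (G : (X × ℕ) × ℕ → ℝ) : Prop where
  iterSum : IterSum D Q (d + 1) G
  start : ∃ c : ℚ, ∀ x b, D (x, b) → G ((x, b), 1) = c
  diag : ∃ F, LastTerm D Q d F ∧ ∀ x b n, D (x, b + 1) → 0 < n → n ≤ b →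
    G ((x, b + 1), n + 1) = G ((x, b), n) + F ((x, b), n)
  step : (∃ F, IterSum D Q d F ∧ ∀ x b n, D (x, b + 1) → 0 < n → n ≤ b →
      G ((x, b + 1), n) = G ((x, b), n) + F ((x, b), n)) ∨
    ∃ F, IterSum D Q d F ∧ ∀ x b n, D (x, b + 1) → 0 < n → n ≤ b →
      G ((x, b + 1), n + 1) = G ((x, b), n) + F ((x, b), n)

lemma Steady.one (d : ℕ) : Steady D Q d 1 where
  iterSum := .coef (one_mem _)
  start := ⟨1, by simp⟩
  diag := ⟨0, (IterSum.zero d).last, by simp⟩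
  step := .inl ⟨0, .zero d, by simp⟩

lemma Steady.sum_last {d : ℕ} {H : (X × ℕ) × ℕ → ℝ} (hH : Steady D Q d H)
    {q : X × ℕ → ℝ} (hq : q ∈ Q) :
    ∃ G, Steady D Q (d + 1) G ∧
      IterSum D Q (d + 1) (ssum ((fun p => q (p.1.1, p.2)) * H) - G) := by
  obtain ⟨F, hF, h⟩ | ⟨F, hF, h⟩ := hH.step
  · have hs : IterSum D Q (d + 1) (ssum ((fun p => q (p.1.1, p.2)) * F)) :=
      .sum (last_mem_nextAlg hq) hF
    have key : ∀ x b n, D (x, b + 1) → 0 < n → n ≤ b →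
        ssum ((fun p => q (p.1.1, p.2)) * H) ((x, b + 1), n) =
        ssum ((fun p => q (p.1.1, p.2)) * H) ((x, b), n) +
          ssum ((fun p => q (p.1.1, p.2)) * F) ((x, b), n) := by
      intro x b n hD hn hb
      simp only [ssum, ← psum_add]
      refine psum_congr fun m hm hlt => ?_
      simp only [Pi.mul_apply, h x b m hD hm (by omega)]
      ring
    refine ⟨ssum ((fun p => q (p.1.1, p.2)) * H), ⟨.sum (last_mem_nextAlg hq) hH.iterSum,
      ⟨0, fun x b _ => by simp [ssum]⟩, ⟨_, .add hs.last (.mk hq (.add hH.iterSum hF.succ)), ?_⟩,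
      .inl ⟨_, hs, key⟩⟩, ?_⟩
    · intro x b n hD hn hb
      have e := key x b n hD hn hb
      have e' := h x b n hD hn hb
      simp only [ssum] at e
      simp only [ssum, psum_succ _ hn, Pi.add_apply]
      rw [e]
      simp only [Pi.mul_apply, e']
      ring
    · rw [sub_self]; exact .zero _
  · have hfwd := hH.iterSum.fwd
    have hs : IterSum D Q (d + 1) (ssum ((fun p => q (p.1.1, p.2)) *
        (F - fun p => H (p.1, p.2 + 1) - H p))) :=
      (IterTerm.mul (last_mem_nextAlg hq) (hF.term.sub hfwd)).ssum
    have key : ∀ x b n, D (x, b + 1) → 0 < n → n ≤ b →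
        ssum ((fun p => q (p.1.1, p.2)) * fun p => H (p.1, p.2 + 1)) ((x, b + 1), n) =
        ssum ((fun p => q (p.1.1, p.2)) * fun p => H (p.1, p.2 + 1)) ((x, b), n) +
          ssum ((fun p => q (p.1.1, p.2)) *
            (F - fun p => H (p.1, p.2 + 1) - H p)) ((x, b), n) := by
      intro x b n hD hn hb
      simp only [ssum, ← psum_add]
      refine psum_congr fun m hm hlt => ?_
      simp only [Pi.mul_apply, Pi.sub_apply, h x b m hD hm (by omega)]
      ring
    refine ⟨ssum ((fun p => q (p.1.1, p.2)) * fun p => H (p.1, p.2 + 1)), ⟨?_,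
      ⟨0, fun x b _ => by simp [ssum]⟩, ⟨_, .add hs.last (.mk hq (.add hH.iterSum hF.succ)), ?_⟩,
      .inl ⟨_, hs, key⟩⟩, ?_⟩
    · refine (IterTerm.mul (last_mem_nextAlg hq) (.congr (.add hH.iterSum.term
        (hfwd.mono d.le_succ)) fun p _ => ?_)).ssum
      simp
    · intro x b n hD hn hb
      have e := key x b n hD hn hb
      have e' := h x b n hD hn hb
      simp only [ssum] at e
      simp only [ssum, psum_succ _ hn, Pi.add_apply]
      rw [e]
      simp only [Pi.mul_apply, e']
      ring
    · refine .congr ((IterTerm.mul (last_mem_nextAlg (neg_mem hq)) hfwd).ssum) fun p _ => ?_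
      simp only [ssum, Pi.sub_apply, ← psum_sub]
      refine psum_congr fun m _ _ => ?_
      simp only [Pi.mul_apply, Pi.neg_apply]
      ring

lemma pole_pow_mem_nextAlg (j : ℕ) : (fun p => (((p.1.2 : ℝ) - p.2)⁻¹) ^ j) ∈ nextAlg D Q :=
  pow_mem pole_mem_nextAlg j

lemma Steady.sum_pole (hinv : (fun p => (p.2 : ℝ)⁻¹) ∈ Q) {d : ℕ} {H : (X × ℕ) × ℕ → ℝ}
    (hH : Steady D Q d H) (j : ℕ) :
    Steady D Q (d + 1) (ssum ((fun p => (((p.1.2 : ℝ) - p.2)⁻¹) ^ j) * H)) := by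
  obtain ⟨c, hc⟩ := hH.start
  obtain ⟨F, hF, h⟩ := hH.diag
  have hs : IterSum D Q (d + 1) ((fun p : (X × ℕ) × ℕ => c • (((p.1.2 : ℝ)⁻¹) ^ j)) +
      ssum ((fun p => (((p.1.2 : ℝ) - p.2)⁻¹) ^ j) * F)) :=
    .add (.coef (Subalgebra.smul_mem _ (pow_mem (le_sumAlg Q hinv) j) c))
      (IterTerm.mul (pole_pow_mem_nextAlg j) hF.term).ssum
  have key : ∀ x b n, D (x, b + 1) → 0 < n → n ≤ b →
      ssum ((fun p => (((p.1.2 : ℝ) - p.2)⁻¹) ^ j) * H) ((x, b + 1), n + 1) =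
      ssum ((fun p => (((p.1.2 : ℝ) - p.2)⁻¹) ^ j) * H) ((x, b), n) +
        ((fun p : (X × ℕ) × ℕ => c • (((p.1.2 : ℝ)⁻¹) ^ j)) +
          ssum ((fun p : (X × ℕ) × ℕ => (((p.1.2 : ℝ) - p.2)⁻¹) ^ j) * F)) ((x, b), n) := by
    intro x b n hD hn hb
    simp only [ssum, psum_succ_left _ hn, Pi.add_apply, Pi.mul_apply, hc x _ hD]
    rw [add_left_comm, ← psum_add]
    congr 1
    · simp [Rat.smul_def, mul_comm]
    · refine psum_congr fun m hm hlt => ?_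
      rw [h x b m hD hm (by omega)]
      push_cast
      rw [add_sub_add_right_eq_sub]
      ring
  exact ⟨.sum (pole_pow_mem_nextAlg j) hH.iterSum, ⟨0, fun x b _ => by simp [ssum]⟩,
    ⟨_, hs.last, key⟩, .inr ⟨_, hs, key⟩⟩

/-- Partial fraction expansions with respect to the last variable. -/
inductive PartialFrac (D : X × ℕ → Prop) (Q : Subalgebra ℚ (X × ℕ → ℝ)) :
    ((X × ℕ) × ℕ → ℝ) → Prop
  | last {k q} (hk : k ∈ sumAlg Q) (hq : q ∈ Q) :
      PartialFrac D Q (fun p => k p.1 * q (p.1.1, p.2))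
  | pole {k} (hk : k ∈ sumAlg Q) (j : ℕ) :
      PartialFrac D Q (fun p => k p.1 * (((p.1.2 : ℝ) - p.2)⁻¹) ^ j)
  | add {F G} (hF : PartialFrac D Q F) (hG : PartialFrac D Q G) : PartialFrac D Q (F + G)
  | congr {F G} (hF : PartialFrac D Q F) (h : ∀ p, nextDom D p → F p = G p) : PartialFrac D Q G

lemma PartialFrac.monomial (hQ : IsSplitting D Q) (j : ℕ) : ∀ {k q : X × ℕ → ℝ},
    k ∈ sumAlg Q → q ∈ Q →
    PartialFrac D Q (fun p => k p.1 * q (p.1.1, p.2) * (((p.1.2 : ℝ) - p.2)⁻¹) ^ j) := by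
  induction j with
  | zero => exact fun hk hq => .congr (.last hk hq) fun p _ => by simp
  | succ j ih =>
    intro k q hk hq
    obtain ⟨F, hF, h⟩ := hQ.divDiff q hq
    have hF' : PartialFrac D Q (fun p => k p.1 * F p * (((p.1.2 : ℝ) - p.2)⁻¹) ^ j) := by
      clear h
      induction hF using AddSubmonoid.closure_induction with
      | mem F hF =>
        obtain ⟨u, hu, v, hv, rfl⟩ := hF
        exact .congr (ih (mul_mem hk (le_sumAlg Q hu)) hv) fun p _ => by simp [mul_assoc]
      | zero => exact .congr (ih (zero_mem _) (one_mem _)) fun p _ => by simp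
      | add F G _ _ hF hG =>
        refine .congr (.add hF hG) fun p _ => ?_
        simp only [Pi.add_apply]
        ring
    have hneg : ∀ {G}, PartialFrac D Q G → PartialFrac D Q (-G) := by
      intro G hG
      induction hG with
      | last hk hq => exact .congr (.last (neg_mem hk) hq) fun p _ => by simp
      | pole hk j => exact .congr (.pole (neg_mem hk) j) fun p _ => by simp
      | add _ _ h₁ h₂ =>
        refine .congr (.add h₁ h₂) fun p _ => ?_
        simp only [Pi.add_apply, Pi.neg_apply]
        ring
      | congr _ h ih => exact .congr ih fun p hp => by simp [h p hp]
    refine .congr (.add (.pole (mul_mem hk (le_sumAlg Q hq)) (j + 1)) (hneg hF')) fun p hp => ?_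
    have e := h p hp
    have h₀ : (p.1.2 : ℝ) - p.2 ≠ 0 := by
      have : (p.2 : ℝ) < p.1.2 := by exact_mod_cast hp.2.2
      linarith
    have e' : q (p.1.1, p.2) = q p.1 - ((p.1.2 : ℝ) - p.2) * F p := by linarith
    have e'' : ((p.1.2 : ℝ) - p.2) * ((p.1.2 : ℝ) - p.2)⁻¹ = 1 := mul_inv_cancel₀ h₀
    simp only [Pi.add_apply, Pi.neg_apply, Pi.mul_apply, e', pow_succ]
    linear_combination (-(k p.1 * F p * (((p.1.2 : ℝ) - p.2)⁻¹) ^ j)) * (-e'')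

lemma PartialFrac.of_mem (hQ : IsSplitting D Q) {l : (X × ℕ) × ℕ → ℝ} (hl : l ∈ nextAlg D Q) :
    PartialFrac D Q l := by
  induction hl using Algebra.adjoin_induction with
  | mem l hl =>
    obtain ((⟨k, hk, rfl⟩ | ⟨q, hq, rfl⟩) | rfl) | hl := hl
    · exact .congr (.last hk (one_mem _)) fun p _ => by simp
    · exact .congr (.last (one_mem _) hq) fun p _ => by simp
    · exact .congr (.pole (one_mem _) 1) fun p _ => by simp
    · exact .congr (.last (zero_mem _) (zero_mem _)) fun p hp => by simp [hl p hp]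
  | algebraMap c =>
    exact .congr (.last (Subalgebra.algebraMap_mem _ c) (one_mem _)) fun p _ => by
      simp [Pi.algebraMap_apply]
  | add _ _ _ _ h₁ h₂ => exact .add h₁ h₂
  | mul f g _ _ hf hg =>
    clear * - hQ hf hg
    induction hf with
    | @last k q hk hq =>
      induction hg with
      | last hk' hq' =>
        exact .congr (.last (mul_mem hk hk') (mul_mem hq hq')) fun p _ => by
          simp only [Pi.mul_apply]; ring
      | pole hk' j =>
        exact .congr (.monomial hQ j (mul_mem hk hk') hq) fun p _ => by
          simp only [Pi.mul_apply]; ring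
      | add _ _ h₁ h₂ => rw [mul_add]; exact .add h₁ h₂
      | congr _ h ih => exact .congr ih fun p hp => by simp [h p hp]
    | @pole k hk j =>
      induction hg with
      | last hk' hq' =>
        exact .congr (.monomial hQ j (mul_mem hk hk') hq') fun p _ => by
          simp only [Pi.mul_apply]; ring
      | pole hk' j' =>
        exact .congr (.pole (mul_mem hk hk') (j + j')) fun p _ => by
          simp only [Pi.mul_apply, pow_add]; ring
      | add _ _ h₁ h₂ => rw [mul_add]; exact .add h₁ h₂
      | congr _ h ih => exact .congr ih fun p hp => by simp [h p hp]
    | add _ _ h₁ h₂ => rw [add_mul]; exact .add h₁ h₂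
    | congr _ h ih => exact .congr ih fun p hp => by simp [h p hp]

/-- Combinations of steady sums, up to sums of lower depth. -/
inductive SteadySpan (D : X × ℕ → Prop) (Q : Subalgebra ℚ (X × ℕ → ℝ)) (d : ℕ) :
    ((X × ℕ) × ℕ → ℝ) → Prop
  | steady {k G} (hk : k ∈ sumAlg Q) (hG : Steady D Q d G) :
      SteadySpan D Q d (fun p => k p.1 * G p)
  | low {G} (hG : IterSum D Q d G) : SteadySpan D Q d G
  | add {F G} (hF : SteadySpan D Q d F) (hG : SteadySpan D Q d G) : SteadySpan D Q d (F + G)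
  | congr {F G} (hF : SteadySpan D Q d F) (h : ∀ p, closedDom D p → F p = G p) :
      SteadySpan D Q d G

lemma SteadySpan.sum (hQ : IsSplitting D Q) (hinv : (fun p => (p.2 : ℝ)⁻¹) ∈ Q) {d : ℕ}
    {l H : (X × ℕ) × ℕ → ℝ} (hl : l ∈ nextAlg D Q) (hH : SteadySpan D Q d H) :
    SteadySpan D Q (d + 1) (ssum (l * H)) := by
  induction hH with
  | @steady k G hk hG =>
    have hl' := PartialFrac.of_mem hQ hl
    clear hl
    induction hl' with
    | @last k' q hk' hq =>
      obtain ⟨G', hG', hlow⟩ := hG.sum_last hq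
      refine .congr (.add (.steady (mul_mem hk hk') hG')
        (.low (hlow.coef_mul (mul_mem hk hk')))) fun p _ => ?_
      simp only [Pi.add_apply, Pi.mul_apply, Pi.sub_apply, mul_sub, ssum, add_sub_cancel,
        ← psum_mul_left]
      exact psum_congr fun m _ _ => by ring
    | @pole k' hk' j =>
      refine .congr (.steady (mul_mem hk hk') (hG.sum_pole hinv j)) fun p _ => ?_
      simp only [Pi.mul_apply, ssum, ← psum_mul_left]
      exact psum_congr fun m _ _ => by ring
    | add _ _ h₁ h₂ => rw [add_mul, ssum_add]; exact .add h₁ h₂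
    | congr _ h ih =>
      exact .congr ih fun p hp => ssum_congr (fun p hp => by simp [h p hp]) hp
  | low hG => exact .low (.sum hl hG)
  | add _ _ h₁ h₂ => rw [mul_add, ssum_add]; exact .add h₁ h₂
  | congr _ h ih =>
    exact .congr ih fun p hp => ssum_congr (fun p hp => by simp [h p hp.closed]) hp

lemma IterSum.steadySpan (hQ : IsSplitting D Q) (hinv : (fun p => (p.2 : ℝ)⁻¹) ∈ Q) (d : ℕ) :
    ∀ {G : (X × ℕ) × ℕ → ℝ}, IterSum D Q (d + 1) G → SteadySpan D Q d G := by
  induction d with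
  | zero =>
    intro G hG
    generalize he : 0 + 1 = e at hG
    induction hG with
    | zero e => exact .low (.zero _)
    | coef hk => exact .congr (.steady hk (.one 0)) fun p _ => by simp
    | add _ _ h₁ h₂ => exact .add (h₁ he) (h₂ he)
    | @sum e l H hl hH ih =>
      obtain rfl : e = 0 := by omega
      refine .congr (.low (.zero _)) fun p hp => ?_
      rw [ssum_congr (G := 0) (fun p hp => by simp [hH.eq_zero p hp.closed]) hp]
      simp [ssum, psum]
    | congr _ h ih => exact .congr (ih he) h
  | succ d ihd =>
    intro G hG
    generalize he : d + 1 + 1 = e at hG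
    induction hG with
    | zero e => exact .low (.zero _)
    | coef hk => exact .low (.coef hk)
    | add _ _ h₁ h₂ => exact .add (h₁ he) (h₂ he)
    | @sum e l H hl hH ih =>
      obtain rfl : e = d + 1 := by omega
      exact .sum hQ hinv hl (ihd hH)
    | congr _ h ih => exact .congr (ih he) h

lemma IterSum.diag_mem (hQ : IsSplitting D Q) (hinv : (fun p => (p.2 : ℝ)⁻¹) ∈ Q) (d : ℕ) :
    ∀ {G : (X × ℕ) × ℕ → ℝ}, IterSum D Q d G → (fun p => G (p, p.2)) ∈ sumAlg Q := by
  have hD : ∀ p, D p → closedDom D (p, p.2) := fun p hp => ⟨hp, hQ.pos hp, le_rfl⟩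
  induction d with
  | zero => exact fun hG => hQ.congr (zero_mem _) fun p hp => (hG.eq_zero _ (hD p hp)).symm
  | succ d ihd =>
    intro G hG
    have hG' := hG.steadySpan hQ hinv
    clear hG
    induction hG' with
    | @steady k G hk hG =>
      refine mul_mem hk ?_
      obtain ⟨c, hc⟩ := hG.start
      obtain ⟨F, hF, h⟩ := hG.diag
      have hF' : (fun p => F (p, p.2)) ∈ sumAlg Q := by
        clear h
        induction hF with
        | mk hq hH => exact mul_mem (le_sumAlg Q hq) (ihd hH)
        | add _ _ h₁ h₂ => exact add_mem h₁ h₂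
        | congr _ h ih => exact hQ.congr ih fun p hp => h _ (hD p hp)
      refine hQ.congr (add_mem (Subalgebra.algebraMap_mem _ c) (ssum_mem_sumAlg hF')) ?_
      rintro ⟨x, b⟩ hp
      simp only [Pi.add_apply, Pi.algebraMap_apply, ssum, eq_ratCast]
      have hb := hQ.pos hp
      induction b, hb using Nat.le_induction with
      | base => simp [hc x _ hp]
      | succ b hb ih =>
        rw [psum_succ _ hb, ← add_assoc, ih (hQ.down hp hb b.lt_succ_self)]
        exact (h x b b hp hb le_rfl).symm
    | low hG => exact ihd hG
    | add _ _ h₁ h₂ => exact add_mem h₁ h₂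
    | congr _ h ih => exact hQ.congr ih fun p hp => h _ (hD p hp)

/-- Summing over the last variable up to its upper bound preserves the summation algebras. -/
theorem diag_ssum_mem (hQ : IsSplitting D Q) (hinv : (fun p => (p.2 : ℝ)⁻¹) ∈ Q)
    {F : (X × ℕ) × ℕ → ℝ} (hF : F ∈ sumAlg (nextAlg D Q)) :
    (fun p => ssum F (p, p.2)) ∈ sumAlg Q := by
  obtain ⟨d, hd⟩ : ∃ d, IterTerm D Q d F := by
    induction hF with
    | base hq => exact ⟨1, .congr (.mk hq (.coef (one_mem _))) fun p _ => by simp⟩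
    | add _ _ h₁ h₂ =>
      obtain ⟨d, h₁⟩ := h₁
      obtain ⟨e, h₂⟩ := h₂
      exact ⟨max d e, .add (h₁.mono (le_max_left _ _)) (h₂.mono (le_max_right _ _))⟩
    | mul hq _ ih =>
      obtain ⟨d, ih⟩ := ih
      exact ⟨d, .mul hq ih⟩
    | sum _ ih =>
      obtain ⟨d, ih⟩ := ih
      exact ⟨d + 1, ih.ssum.term⟩
  exact hd.ssum.diag_mem hQ hinv

end Diagonal

/-! ### Nested sums -/

/-- Tuples of natural numbers of length `k`. -/
def Tuple : ℕ → Type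
  | 0 => Unit
  | k + 1 => Tuple k × ℕ

/-- The points `(s₀, …, s_k)` with `s₀ > ⋯ > s_k > 0`. -/
def towerDom : (k : ℕ) → Tuple k × ℕ → Prop
  | 0 => fun p => 0 < p.2
  | k + 1 => nextDom (towerDom k)

/-- Algebras of rational functions on the points `(s₀, …, s_k)`, closed under summation. -/
noncomputable def towerAlg : (k : ℕ) → Subalgebra ℚ (Tuple k × ℕ → ℝ)
  | 0 => Algebra.adjoin ℚ
      ({fun p => (p.2 : ℝ), fun p => (p.2 : ℝ)⁻¹} ∪ {f | ∀ p, towerDom 0 p → f p = 0})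
  | k + 1 => nextAlg (towerDom k) (towerAlg k)

/-- The coordinates of a point `(s₀, …, s_k)`. -/
def coord : (k : ℕ) → Tuple k × ℕ → ℕ → ℕ
  | 0 => fun p _ => p.2
  | k + 1 => fun p i => if i ≤ k then coord k p.1 i else p.2

/-- The sum of `f (N, s₁, …, s_k)` over all `N > s₁ > ⋯ > s_k > 0`. -/
noncomputable def nest : (k : ℕ) → (Tuple k × ℕ → ℝ) → ℕ → ℝ
  | 0 => fun f N => f ((), N)
  | k + 1 => fun f => nest k fun p : Tuple k × ℕ => ssum f (p, p.2)

lemma isSplitting_towerAlg (k : ℕ) : IsSplitting (towerDom k) (towerAlg k) := by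
  induction k with
  | zero =>
    refine ⟨fun _ hn _ => hn, fun h => h, fun hf => Algebra.subset_adjoin (.inr hf), ?_⟩
    refine divDiff_adjoin ?_
    rintro q ((rfl | rfl) | hq)
    · exact ⟨_, AddSubmonoid.subset_closure ⟨1, one_mem _, 1, one_mem _, rfl⟩, by simp⟩
    · have hm : (fun p : Tuple 0 × ℕ => (p.2 : ℝ)⁻¹) ∈ Algebra.adjoin ℚ
          ({fun p => (p.2 : ℝ), fun p => (p.2 : ℝ)⁻¹} ∪
            {f : Tuple 0 × ℕ → ℝ | ∀ p, towerDom 0 p → f p = 0}) :=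
        Algebra.subset_adjoin (.inl (.inr rfl))
      refine ⟨_, AddSubmonoid.subset_closure ⟨_, neg_mem hm, _, hm, rfl⟩, fun p hp => ?_⟩
      obtain ⟨h₀, h₁, h₂⟩ := hp
      have h₁' : (p.2 : ℝ) ≠ 0 := by positivity
      have h₂' : (p.1.2 : ℝ) ≠ 0 := by
        have : 0 < p.1.2 := h₁.trans h₂
        positivity
      simp only [Pi.neg_apply]
      field_simp
      ring
    · refine ⟨0, zero_mem _, fun p hp => ?_⟩
      rw [hq p.1 hp.1, hq (p.1.1, p.2) hp.2.1]
      simp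
  | succ k ih => exact ih.next

lemma last_mem_towerAlg (k : ℕ) : (fun p => (p.2 : ℝ)) ∈ towerAlg k := by
  induction k with
  | zero => exact Algebra.subset_adjoin (.inl (.inl rfl))
  | succ k ih => exact last_mem_nextAlg ih

lemma last_inv_mem_towerAlg (k : ℕ) : (fun p => (p.2 : ℝ)⁻¹) ∈ towerAlg k := by
  induction k with
  | zero => exact Algebra.subset_adjoin (.inl (.inr rfl))
  | succ k ih => exact last_mem_nextAlg ih

lemma coord_self (k : ℕ) (p : Tuple k × ℕ) : coord k p k = p.2 := by
  cases k <;> simp [coord]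

lemma coord_lt {k i : ℕ} (hi : i < k) (x : Tuple k) (n m : ℕ) :
    coord k (x, n) i = coord k (x, m) i := by
  cases k with
  | zero => omega
  | succ k => simp [coord, Nat.lt_succ_iff.1 hi]

lemma coord_of_le {k i : ℕ} (hi : i ≤ k) (p : Tuple (k + 1) × ℕ) :
    coord (k + 1) p i = coord k p.1 i :=
  if_pos hi

lemma lift_mem_towerAlg {k : ℕ} {f : Tuple k × ℕ → ℝ} (hf : f ∈ towerAlg k) :
    (fun p : Tuple (k + 1) × ℕ => f p.1) ∈ towerAlg (k + 1) :=
  coef_mem_nextAlg (le_sumAlg _ hf)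

lemma skip_mem_towerAlg {k : ℕ} {f : Tuple k × ℕ → ℝ} (hf : f ∈ towerAlg k) :
    (fun p : Tuple (k + 1) × ℕ => f (p.1.1, p.2)) ∈ towerAlg (k + 1) :=
  last_mem_nextAlg hf

lemma pole_mem_towerAlg {k : ℕ} :
    (fun p : Tuple (k + 1) × ℕ => ((p.1.2 : ℝ) - p.2)⁻¹) ∈ towerAlg (k + 1) :=
  pole_mem_nextAlg

lemma coord_mem_towerAlg {k i : ℕ} (hi : i ≤ k) :
    (fun p => (coord k p i : ℝ)) ∈ towerAlg k := by
  induction k, hi using Nat.le_induction with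
  | base => simpa only [coord_self] using last_mem_towerAlg i
  | succ k hi ih => simpa only [coord_of_le hi] using lift_mem_towerAlg ih

lemma coord_inv_mem_towerAlg {k i : ℕ} (hi : i ≤ k) :
    (fun p => (coord k p i : ℝ)⁻¹) ∈ towerAlg k := by
  induction k, hi using Nat.le_induction with
  | base => simpa only [coord_self] using last_inv_mem_towerAlg i
  | succ k hi ih => simpa only [coord_of_le hi] using lift_mem_towerAlg ih

lemma coord_sub_inv_mem_towerAlg {k i j : ℕ} (hij : i < j) (hj : j ≤ k) :
    (fun p => ((coord k p i : ℝ) - coord k p j)⁻¹) ∈ towerAlg k := by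
  induction k generalizing j with
  | zero => omega
  | succ k ih =>
    obtain rfl | hj := hj.eq_or_lt
    · simp only [coord_self, coord_of_le (Nat.lt_succ_iff.1 hij)]
      obtain rfl | hi := (Nat.lt_succ_iff.1 hij).eq_or_lt
      · convert pole_mem_towerAlg (k := i) using 5 with p
        exact coord_self i p.1
      · have := skip_mem_towerAlg (ih hi le_rfl)
        have e : ∀ p : (Tuple k × ℕ) × ℕ, coord k (p.1.1, p.2) i = coord k p.1 i :=
          fun p => coord_lt hi _ _ _
        simp only [coord_self] at this
        convert this using 4 with p
        exact congrArg _ (e p).symm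
    · have hj' := Nat.lt_succ_iff.1 hj
      simp only [coord_of_le hj', coord_of_le (hij.le.trans hj')]
      exact lift_mem_towerAlg (ih hij hj')

/-- Nested sums of functions in the tower algebras can be written in one variable. -/
theorem nest_mem_sumAlg (k : ℕ) : ∀ {f : Tuple k × ℕ → ℝ}, f ∈ sumAlg (towerAlg k) →
    (fun p => nest k f p.2) ∈ sumAlg (towerAlg 0) := by
  induction k with
  | zero => exact fun hf => hf
  | succ k ih =>
    exact fun hf => ih (diag_ssum_mem (isSplitting_towerAlg k) (last_inv_mem_towerAlg k) hf)

section Averages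

/-! ### Convergence of the nested sums -/

open Filter Topology

/-- The weighted sum `∑_{0 < n < b} (n / b) ^ l c(n) / n`. -/
noncomputable def avg (l : ℕ) (c : ℕ → ℝ) (b : ℕ) : ℝ :=
  psum (fun n => ((n : ℝ) / b) ^ l / n * c n) b

lemma avg_eq (l : ℕ) (c : ℕ → ℝ) (b : ℕ) :
    avg (l + 1) c b = psum (fun n => (n : ℝ) ^ l * c n) b / (b : ℝ) ^ (l + 1) := by
  rw [avg, div_eq_inv_mul, ← psum_mul_left]
  refine psum_congr fun m hm hlt => ?_
  have h₁ : (m : ℝ) ≠ 0 := by positivity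
  have h₂ : (b : ℝ) ≠ 0 := by
    have := hm.trans hlt
    positivity
  rw [div_pow]
  field_simp
  ring

lemma pow_succ_add_le (l : ℕ) (x : ℝ) (hx : 0 ≤ x) :
    x ^ (l + 1) + (l + 1) * x ^ l ≤ (x + 1) ^ (l + 1) := by
  induction l with
  | zero => simp
  | succ l ih =>
    have h : 0 ≤ x ^ l := by positivity
    have hl : (0 : ℝ) ≤ l := by positivity
    calc x ^ (l + 1 + 1) + ((l + 1 : ℕ) + 1) * x ^ (l + 1)
        ≤ (x ^ (l + 1) + (l + 1) * x ^ l) * (x + 1) := by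
          push_cast; simp only [pow_succ]; nlinarith [mul_nonneg hl h]
      _ ≤ (x + 1) ^ (l + 1) * (x + 1) := by gcongr
      _ = _ := by rw [← pow_succ]

lemma le_pow_succ_add (l : ℕ) (x : ℝ) (hx : 0 ≤ x) :
    (x + 1) ^ (l + 1) ≤ x ^ (l + 1) + (l + 1) * (x + 1) ^ l := by
  induction l with
  | zero => simp
  | succ l ih =>
    have h : x ^ (l + 1) ≤ (x + 1) ^ (l + 1) := by gcongr; linarith
    calc (x + 1) ^ (l + 1 + 1) = (x + 1) ^ (l + 1) * (x + 1) := pow_succ _ _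
      _ ≤ (x ^ (l + 1) + (l + 1) * (x + 1) ^ l) * (x + 1) := by gcongr
      _ = x ^ (l + 1 + 1) + x ^ (l + 1) + (l + 1) * (x + 1) ^ (l + 1) := by ring
      _ ≤ _ := by push_cast; linarith

lemma psum_mono {f g : ℕ → ℝ} {n : ℕ} (h : ∀ m, 0 < m → m < n → f m ≤ g m) :
    psum f n ≤ psum g n :=
  Finset.sum_le_sum fun m hm => h m (Finset.mem_Ico.1 hm).1 (Finset.mem_Ico.1 hm).2

lemma psum_nonneg {f : ℕ → ℝ} {n : ℕ} (h : ∀ m, 0 < m → m < n → 0 ≤ f m) : 0 ≤ psum f n :=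
  Finset.sum_nonneg fun m hm => h m (Finset.mem_Ico.1 hm).1 (Finset.mem_Ico.1 hm).2

lemma avg_nonneg {l : ℕ} {c : ℕ → ℝ} (hc : ∀ n, 0 < n → 0 ≤ c n) (b : ℕ) : 0 ≤ avg l c b :=
  psum_nonneg fun m hm _ => mul_nonneg (by positivity) (hc m hm)

lemma psum_pow_le (l b : ℕ) : (l + 1) * psum (fun n => (n : ℝ) ^ l) b ≤ (b : ℝ) ^ (l + 1) := by
  induction b with
  | zero => simp
  | succ b ih =>
    rcases Nat.eq_zero_or_pos b with rfl | hb
    · simp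
    · have := pow_succ_add_le l b b.cast_nonneg
      rw [psum_succ _ hb]
      push_cast
      linarith

lemma avg_le {l : ℕ} {c : ℕ → ℝ} {γ : ℝ} (hγ : 0 ≤ γ) (hc : ∀ n, 0 < n → c n ≤ γ) {b : ℕ}
    (hb : 0 < b) : avg (l + 1) c b ≤ γ / (l + 1) := by
  have hb' : (0 : ℝ) < b := by positivity
  rw [avg_eq, div_le_div_iff₀ (by positivity) (by positivity)]
  calc psum (fun n => (n : ℝ) ^ l * c n) b * (l + 1)
      ≤ psum (fun n => γ * (n : ℝ) ^ l) b * (l + 1) := by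
        gcongr
        refine psum_mono fun m hm _ => ?_
        rw [mul_comm]
        gcongr
        exact hc m hm
    _ = γ * ((l + 1) * psum (fun n => (n : ℝ) ^ l) b) := by rw [psum_mul_left]; ring
    _ ≤ _ := by gcongr; exact psum_pow_le l b

lemma tendsto_pow_div_sub (l : ℕ) :
    Tendsto (fun n : ℕ => (n : ℝ) ^ l / (((n : ℝ) + 1) ^ (l + 1) - (n : ℝ) ^ (l + 1))) atTop
      (𝓝 (1 / (l + 1))) := by
  have h₁ : Tendsto (fun n : ℕ => ((n : ℝ) / (n + 1)) ^ l / (l + 1)) atTop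
      (𝓝 (1 / (l + 1))) := by
    have := ((tendsto_natCast_div_add_atTop (1 : ℝ)).pow l).div_const ((l : ℝ) + 1)
    simpa using this
  refine tendsto_of_tendsto_of_tendsto_of_le_of_le' h₁ tendsto_const_nhds ?_ ?_
  all_goals
    filter_upwards [eventually_gt_atTop 0] with n hn
    have hn' : (0 : ℝ) < n := by positivity
    have e₁ := pow_succ_add_le l n hn'.le
    have e₂ := le_pow_succ_add l n hn'.le
    have e₃ : 0 < (n : ℝ) ^ l := by positivity
    have e₄ : 0 < ((n : ℝ) + 1) ^ (l + 1) - (n : ℝ) ^ (l + 1) := by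
      have : 0 < ((l : ℝ) + 1) * (n : ℝ) ^ l := by positivity
      linarith
  · rw [div_pow, div_div, div_le_div_iff₀ (by positivity) e₄]
    gcongr
    linarith
  · rw [div_le_div_iff₀ e₄ (by positivity)]
    linarith

lemma tendsto_avg {l : ℕ} {c : ℕ → ℝ} {γ : ℝ} (hc : Tendsto c atTop (𝓝 γ)) :
    Tendsto (avg (l + 1) c) atTop (𝓝 (γ / (l + 1))) := by
  set g : ℕ → ℝ := fun n => ((n : ℝ) + 1) ^ (l + 1) - (n : ℝ) ^ (l + 1) with hg
  have hgpos : ∀ n, 0 < g n := fun n => by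
    have : (n : ℝ) < n + 1 := by linarith
    have := pow_lt_pow_left₀ this (Nat.cast_nonneg n) (Nat.succ_ne_zero l)
    simp only [hg, Nat.succ_eq_add_one] at this ⊢; linarith
  have hgsum : ∀ b, ∑ n ∈ range b, g n = (b : ℝ) ^ (l + 1) := fun b => by
    have := Finset.sum_range_sub (fun n : ℕ => (n : ℝ) ^ (l + 1)) b
    push_cast at this
    simpa [hg] using this
  have hlim : Tendsto (fun n : ℕ => (n : ℝ) ^ l * c n / g n) atTop (𝓝 (γ / (l + 1))) := by
    have := (tendsto_pow_div_sub l).mul hc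
    rw [one_div_mul_eq_div] at this
    refine this.congr fun n => ?_
    simp only [hg]; ring
  have hf : (fun n : ℕ => (n : ℝ) ^ l * c n - γ / (l + 1) * g n) =o[atTop] g := by
    rw [Asymptotics.isLittleO_iff_tendsto fun n hn => absurd hn (hgpos n).ne']
    have := hlim.sub_const (γ / (l + 1))
    rw [sub_self] at this
    refine this.congr fun n => ?_
    have := (hgpos n).ne'
    field_simp
  have hpow : Tendsto (fun b : ℕ => (b : ℝ) ^ (l + 1)) atTop atTop :=
    (tendsto_pow_atTop l.succ_ne_zero).comp tendsto_natCast_atTop_atTop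
  have hs := hf.sum_range (fun n => (hgpos n).le) (by simpa only [hgsum] using hpow)
  simp only [hgsum, Finset.sum_sub_distrib, ← Finset.mul_sum] at hs
  have hs' := hs.tendsto_div_nhds_zero
  have h₀ : Tendsto (fun b : ℕ => (((0 : ℕ) : ℝ) ^ l * c 0) / (b : ℝ) ^ (l + 1)) atTop (𝓝 0) :=
    tendsto_const_nhds.div_atTop hpow
  have := (hs'.sub h₀).add_const (γ / (l + 1))
  rw [sub_zero, zero_add] at this
  refine this.congr' ?_
  filter_upwards [eventually_gt_atTop 0] with b hb
  have hb' : (b : ℝ) ^ (l + 1) ≠ 0 := by positivity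
  rw [avg_eq, psum, Finset.range_eq_Ico, Finset.sum_eq_sum_Ico_succ_bot hb]
  field_simp
  ring

/-- The weight `∏_{i < k} (s_{i+1} / s_i) ^ {l_i} / s_{i+1}`. -/
noncomputable def weight (k : ℕ) (l : ℕ → ℕ) (p : Tuple k × ℕ) : ℝ :=
  ∏ i ∈ range k, ((coord k p (i + 1) : ℝ) / coord k p i) ^ l i / coord k p (i + 1)

lemma weight_succ (k : ℕ) (l : ℕ → ℕ) (p : Tuple k × ℕ) (n : ℕ) :
    weight (k + 1) l (p, n) = weight k l p * (((n : ℝ) / p.2) ^ l k / n) := by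
  have h : ∀ i ≤ k, coord (k + 1) (p, n) i = coord k p i := fun i hi => coord_of_le hi _
  rw [weight, prod_range_succ, coord_self, h k le_rfl, coord_self, weight]
  congr 1
  refine prod_congr rfl fun i hi => ?_
  have hi := mem_range.1 hi
  rw [h i hi.le, h (i + 1) hi]

lemma nest_weight_succ (k : ℕ) (l : ℕ → ℕ) (c : ℕ → ℝ) :
    nest (k + 1) (fun p => weight (k + 1) l p * c p.2) =
      nest k (fun p => weight k l p * avg (l k) c p.2) := by
  refine congrArg (nest k) (funext fun p => ?_)
  change psum (fun m => weight (k + 1) l (p, m) * c m) p.2 = weight k l p * psum _ p.2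
  rw [← psum_mul_left]
  refine psum_congr fun m _ _ => ?_
  rw [weight_succ k l p m, mul_assoc]

lemma nest_weight (k : ℕ) (l : ℕ → ℕ) (hl : ∀ i < k, 0 < l i) : ∀ (c : ℕ → ℝ) (γ : ℝ),
    (∀ n, 0 < n → 0 ≤ c n) → (∀ n, 0 < n → c n ≤ γ) → Tendsto c atTop (𝓝 γ) →
    (∀ N, 0 < N → 0 ≤ nest k (fun p => weight k l p * c p.2) N) ∧
    (∀ N, 0 < N → nest k (fun p => weight k l p * c p.2) N ≤ γ / ∏ i ∈ range k, (l i : ℝ)) ∧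
    Tendsto (nest k (fun p => weight k l p * c p.2)) atTop
      (𝓝 (γ / ∏ i ∈ range k, (l i : ℝ))) := by
  induction k with
  | zero =>
    intro c γ h₀ h₁ h₂
    simpa [nest, weight] using ⟨h₀, h₁, h₂⟩
  | succ k ih =>
    intro c γ h₀ h₁ h₂
    have hγ : 0 ≤ γ := (h₀ 1 one_pos).trans (h₁ 1 one_pos)
    obtain ⟨m, hm⟩ := Nat.exists_eq_succ_of_ne_zero (hl k k.lt_succ_self).ne'
    have hm' : (l k : ℝ) = m + 1 := by rw [hm]; push_cast; rfl
    rw [nest_weight_succ, prod_range_succ, mul_comm, ← div_div, hm', hm]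
    exact ih (fun i hi => hl i (hi.trans k.lt_succ_self)) _ _ (fun n _ => avg_nonneg h₀ n)
      (fun n hn => avg_le hγ h₁ hn) (tendsto_avg h₂)

lemma hasSum_nest {ι : Type*} (k : ℕ) : ∀ {f : ι → Tuple k × ℕ → ℝ} {g : Tuple k × ℕ → ℝ},
    (∀ p, towerDom k p → HasSum (fun y => f y p) (g p)) → ∀ {N : ℕ}, 0 < N →
    HasSum (fun y => nest k (f y) N) (nest k g N) := by
  induction k with
  | zero => exact fun h N hN => h ((), N) hN
  | succ k ih =>
    intro f g h N hN
    refine ih (fun p hp => ?_) hN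
    exact hasSum_sum fun m hm => h (p, m) ⟨hp, (mem_Ico.1 hm).1, (mem_Ico.1 hm).2⟩

lemma hasSum_prod_geometric {n : ℕ} (T : Fin n → ℝ) (h₀ : ∀ j, 0 ≤ T j) (h₁ : ∀ j, T j < 1) :
    HasSum (fun y : Fin n → ℕ => ∏ j, T j ^ (y j + 1)) (∏ j, T j * (1 - T j)⁻¹) := by
  induction n with
  | zero => simp
  | succ n ih =>
    have h := ih (fun j => T j.succ) (fun j => h₀ _) (fun j => h₁ _)
    have hg : HasSum (fun m : ℕ => T 0 ^ (m + 1)) (T 0 * (1 - T 0)⁻¹) := by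
      simpa [pow_succ'] using (hasSum_geometric_of_lt_one (h₀ 0) (h₁ 0)).mul_left (T 0)
    have hs := hg.summable.mul_of_nonneg h.summable
      (fun m => pow_nonneg (h₀ 0) _) fun y => prod_nonneg fun j _ => pow_nonneg (h₀ _) _
    have hm := hg.mul h hs
    rw [Fin.prod_univ_succ]
    refine ((Fin.consEquiv fun _ => ℕ).hasSum_iff.1 ?_)
    have e : (fun y : Fin (n + 1) → ℕ => ∏ j, T j ^ (y j + 1)) ∘ (Fin.consEquiv fun _ => ℕ) =
        fun x => T 0 ^ (x.1 + 1) * ∏ j, T j.succ ^ (x.2 j + 1) := by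
      funext y
      simp [Fin.prod_univ_succ, Fin.consEquiv]
    rw [e]
    exact hm

end Averages

section ConicalSums

open Filter Topology

lemma towerDom.pos {k : ℕ} {p : Tuple k × ℕ} (hp : towerDom k p) {i : ℕ} (hi : i ≤ k) :
    0 < coord k p i := by
  induction k with
  | zero => exact hp
  | succ k ih =>
    obtain ⟨h₁, h₂, h₃⟩ := hp
    obtain rfl | hi := hi.eq_or_lt
    · rwa [coord_self]
    · rw [coord_of_le (Nat.lt_succ_iff.1 hi)]
      exact ih h₁ (Nat.lt_succ_iff.1 hi)

lemma towerDom.lt {k : ℕ} {p : Tuple k × ℕ} (hp : towerDom k p) {i : ℕ} (hi : i < k) :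
    coord k p (i + 1) < coord k p i := by
  induction k with
  | zero => omega
  | succ k ih =>
    obtain ⟨h₁, h₂, h₃⟩ := hp
    rw [coord_of_le (Nat.lt_succ_iff.1 hi)]
    obtain rfl | hi := (Nat.lt_succ_iff.1 hi).eq_or_lt
    · rw [coord_self]
      exact h₃.trans_eq (coord_self i p.1).symm
    · rw [coord_of_le hi]
      exact ih h₁ hi

lemma towerDom.prod_Ico {k : ℕ} {p : Tuple k × ℕ} (hp : towerDom k p) {a b : ℕ} (hab : a ≤ b)
    (hb : b ≤ k) :
    ∏ i ∈ Ico a b, ((coord k p (i + 1) : ℝ) / coord k p i) = coord k p b / coord k p a := by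
  have hne : ∀ i ≤ k, (coord k p i : ℝ) ≠ 0 := fun i hi => by
    have := hp.pos hi
    positivity
  induction b, hab using Nat.le_induction with
  | base => simp [div_self (hne a hb)]
  | succ b hab ih =>
    rw [prod_Ico_succ_top hab, ih (by omega)]
    have h₁ := hne b (by omega)
    have h₂ := hne a (by omega)
    field_simp

/-- A conical sum with consecutive ones is the limit of a function of one variable obtained
by iterated summation. -/
theorem exists_mem_sumAlg_tendsto {r n : ℕ} (A : Fin r → Fin n → ℕ)
    (hrow : ∀ i, ∃ j, A i j = 1) (lo hi : Fin n → ℕ) (hlt : ∀ j, lo j < hi j)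
    (hr : ∀ j, hi j ≤ r)
    (hA : ∀ (i : Fin r) j, A i j = if lo j ≤ i ∧ (i : ℕ) < hi j then 1 else 0)
    (hs : Summable fun y : Fin n → ℕ => ∏ i, (1 : ℝ) / ∑ j, (A i j : ℝ) * ((y j : ℝ) + 1)) :
    ∃ g ∈ sumAlg (towerAlg 0), Tendsto (fun N => g ((), N)) atTop
      (𝓝 (∑' y : Fin n → ℕ, ∏ i, (1 : ℝ) / ∑ j, (A i j : ℝ) * ((y j : ℝ) + 1))) := by
  set F : Tuple r × ℕ → ℝ := fun p => (∏ j, ((coord r p (hi j) : ℝ) *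
    ((coord r p (lo j) : ℝ) - coord r p (hi j))⁻¹)) * ∏ i ∈ range r, (coord r p (i + 1) : ℝ)⁻¹
    with hF
  have hFmem : F ∈ towerAlg r := by
    have h₁ : ∏ j, ((fun p => (coord r p (hi j) : ℝ)) *
        fun p => ((coord r p (lo j) : ℝ) - coord r p (hi j))⁻¹) ∈ towerAlg r :=
      prod_mem fun j _ => mul_mem (coord_mem_towerAlg (hr j))
        (coord_sub_inv_mem_towerAlg (hlt j) (hr j))
    have h₂ : ∏ i ∈ range r, (fun p => (coord r p (i + 1) : ℝ)⁻¹) ∈ towerAlg r :=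
      prod_mem fun i hi => coord_inv_mem_towerAlg (mem_range.1 hi)
    convert mul_mem h₁ h₂ using 1
    funext p
    simp [hF, Finset.prod_apply]
  refine ⟨_, nest_mem_sumAlg r (le_sumAlg _ hFmem), ?_⟩
  let L : (Fin n → ℕ) → ℕ → ℕ := fun y i => if h : i < r then ∑ j, A ⟨i, h⟩ j * (y j + 1) else 0
  have hL : ∀ y (i : Fin r), L y i = ∑ j, A i j * (y j + 1) := fun y i => by simp [L]
  have hLpos : ∀ y, ∀ i < r, 0 < L y i := fun y i hi => by
    obtain ⟨j, hj⟩ := hrow ⟨i, hi⟩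
    rw [hL y ⟨i, hi⟩]
    exact sum_pos' (fun _ _ => Nat.zero_le _) ⟨j, mem_univ _, by simp [hj]⟩
  have hval : ∀ y, (1 : ℝ) / ∏ i ∈ range r, (L y i : ℝ) =
      ∏ i, (1 : ℝ) / ∑ j, (A i j : ℝ) * ((y j : ℝ) + 1) := fun y => by
    rw [prod_range]
    simp [hL, Finset.prod_inv_distrib]
  have hpt : ∀ p, towerDom r p → HasSum (fun y => weight r (L y) p * 1) (F p) := by
    intro p hp
    have hpos : ∀ i ≤ r, (0 : ℝ) < coord r p i := fun i hi => by exact_mod_cast hp.pos hi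
    have hlt' : ∀ j, (coord r p (hi j) : ℝ) < coord r p (lo j) := by
      intro j
      have : ∀ b, lo j < b → b ≤ r → coord r p b < coord r p (lo j) := by
        intro b hb
        induction b, hb using Nat.le_induction with
        | base => exact fun h => hp.lt h
        | succ b hb ih => exact fun h => (hp.lt h).trans (ih (by omega))
      exact_mod_cast this _ (hlt j) (hr j)
    have h := (hasSum_prod_geometric (fun j => (coord r p (hi j) : ℝ) / coord r p (lo j))
      (fun j => by positivity) (fun j => by
        rw [div_lt_one (hpos _ ((hlt j).le.trans (hr j)))]
        exact hlt' j)).mul_right (∏ i ∈ range r, (coord r p (i + 1) : ℝ)⁻¹)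
    have e₁ : (fun y => weight r (L y) p * 1) = fun y =>
        (∏ j, ((coord r p (hi j) : ℝ) / coord r p (lo j)) ^ (y j + 1)) *
          ∏ i ∈ range r, (coord r p (i + 1) : ℝ)⁻¹ := by
      funext y
      rw [mul_one, weight]
      simp only [div_eq_mul_inv _ ((coord r p (_ + 1) : ℕ) : ℝ), prod_mul_distrib]
      congr 1
      have hT : ∀ j, (coord r p (hi j) : ℝ) / coord r p (lo j) =
          ∏ i : Fin r, ((coord r p (i + 1) : ℝ) / coord r p i) ^ A i j := by
        intro j
        rw [← hp.prod_Ico (hlt j).le (hr j)]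
        simp only [hA, pow_ite, pow_one, pow_zero]
        rw [← prod_range (fun i => if lo j ≤ i ∧ i < hi j then
          ((coord r p (i + 1) : ℝ) / coord r p i) else 1), ← prod_filter]
        refine prod_congr ?_ fun _ _ => rfl
        ext i
        have := hr j
        simp only [mem_Ico, mem_filter, mem_range]
        omega
      simp only [hT, ← prod_pow]
      rw [Finset.prod_comm, Finset.prod_range]
      refine prod_congr rfl fun i _ => ?_
      rw [hL, ← prod_pow_eq_pow_sum]
      exact prod_congr rfl fun j _ => pow_mul _ _ _
    have e₂ : F p = (∏ j, (coord r p (hi j) : ℝ) / coord r p (lo j) *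
        (1 - (coord r p (hi j) : ℝ) / coord r p (lo j))⁻¹) *
          ∏ i ∈ range r, (coord r p (i + 1) : ℝ)⁻¹ := by
      simp only [hF]
      congr 1
      refine prod_congr rfl fun j _ => ?_
      have h₁ := (hpos _ ((hlt j).le.trans (hr j))).ne'
      have h₂ : (coord r p (lo j) : ℝ) - coord r p (hi j) ≠ 0 := (sub_pos.2 (hlt' j)).ne'
      rw [one_sub_div h₁]
      field_simp
    rw [e₁, e₂]
    exact h
  have hw := fun y => nest_weight r (L y) (hLpos y) (fun _ => 1) 1 (fun _ _ => zero_le_one)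
    (fun _ _ => le_rfl) tendsto_const_nhds
  simp only [hval] at hw
  have key := tendsto_tsum_of_dominated_convergence (𝓕 := atTop)
    (f := fun N y => nest r (fun p => weight r (L y) p * 1) N) hs (fun y => (hw y).2.2) (by
      filter_upwards [eventually_gt_atTop 0] with N hN y
      rw [Real.norm_of_nonneg ((hw y).1 N hN)]
      exact (hw y).2.1 N hN)
  refine key.congr' ?_
  filter_upwards [eventually_gt_atTop 0] with N hN
  exact (hasSum_nest r hpt hN).tsum_eq

end ConicalSums

/-! ### Polynomials in `1 / n` and harmonic numbers -/

section LogAlg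

open Filter Topology Asymptotics Polynomial

/-- The harmonic number `∑_{0 < m < n} 1 / m`. -/
noncomputable def harm : ℕ → ℝ := psum fun m => (m : ℝ)⁻¹

variable (S : Subalgebra ℚ ℝ)

/-- The algebra over `S` generated by `1 / n`, by the harmonic numbers and by `n / (n + 1)`. -/
noncomputable def logAlg : Subalgebra S (ℕ → ℝ) :=
  Algebra.adjoin S {fun n : ℕ => (n : ℝ)⁻¹, harm, fun n : ℕ => (1 + (n : ℝ)⁻¹)⁻¹}

namespace logAlg

noncomputable instance : CommRing (logAlg S) := (logAlg S).toCommRing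

noncomputable instance : Algebra S (logAlg S) := (logAlg S).algebra

noncomputable instance : Module S (logAlg S) := Algebra.toModule

noncomputable instance : SMul S (logAlg S) := Algebra.toSMul

/-- The function `1 / n`. -/
noncomputable def recip : logAlg S :=
  ⟨fun n => (n : ℝ)⁻¹, Algebra.subset_adjoin (by simp)⟩

/-- The harmonic numbers. -/
noncomputable def har : logAlg S := ⟨harm, Algebra.subset_adjoin (by simp)⟩

/-- The function `n / (n + 1)`. -/
noncomputable def ratio : logAlg S :=
  ⟨fun n => (1 + (n : ℝ)⁻¹)⁻¹, Algebra.subset_adjoin (by simp)⟩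

lemma ratio_eq : ratio S = 1 - recip S * ratio S := by
  refine Subtype.ext (funext fun n => ?_)
  have : (1 : ℝ) + (n : ℝ)⁻¹ ≠ 0 := by positivity
  simp only [ratio, recip, Subalgebra.coe_sub, Subalgebra.coe_one, Subalgebra.coe_mul,
    Pi.sub_apply, Pi.one_apply, Pi.mul_apply]
  field_simp
  ring

variable {S}

lemma exists_eq_aeval_add (e : logAlg S) :
    ∃ (p : S[X]) (f : logAlg S), e = aeval (har S) p + recip S * f := by
  obtain ⟨e, he⟩ := e
  induction he using Algebra.adjoin_induction with
  | mem e he =>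
    obtain rfl | rfl | rfl := he
    · exact ⟨0, 1, by simp [recip]⟩
    · exact ⟨X, 0, by simp [har]⟩
    · refine ⟨1, -ratio S, ?_⟩
      change ratio S = _
      rw [map_one]
      linear_combination ratio_eq S
  | algebraMap c => exact ⟨C c, 0, by rw [aeval_C]; simp; rfl⟩
  | add e e' he he' h h' =>
    obtain ⟨p, f, h⟩ := h
    obtain ⟨p', f', h'⟩ := h'
    refine ⟨p + p', f + f', ?_⟩
    change (⟨e, he⟩ : logAlg S) + ⟨e', he'⟩ = _
    rw [h, h', map_add]
    ring
  | mul e e' he he' h h' =>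
    obtain ⟨p, f, h⟩ := h
    obtain ⟨p', f', h'⟩ := h'
    refine ⟨p * p', aeval (har S) p * f' + f * aeval (har S) p' + recip S * f * f', ?_⟩
    change (⟨e, he⟩ : logAlg S) * ⟨e', he'⟩ = _
    rw [h, h', map_mul]
    ring

lemma exists_ratio_pow_eq (j : ℕ) :
    ∃ e : logAlg S, ratio S ^ j = 1 - j * recip S + recip S ^ 2 * e := by
  induction j with
  | zero => exact ⟨0, by simp⟩
  | succ j ih =>
    obtain ⟨e, h⟩ := ih
    refine ⟨j * ratio S + e * ratio S + ratio S, ?_⟩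
    have hr := ratio_eq S
    rw [pow_succ, h]
    push_cast
    linear_combination (1 - recip S - j * recip S) * hr

lemma exists_har_add_pow_eq (i : ℕ) :
    ∃ e : logAlg S, (har S + recip S) ^ (i + 1) =
      har S ^ (i + 1) + ((i : logAlg S) + 1) * recip S * har S ^ i + recip S ^ 2 * e := by
  induction i with
  | zero => exact ⟨0, by simp⟩
  | succ i ih =>
    obtain ⟨e, h⟩ := ih
    refine ⟨((i : logAlg S) + 1) * har S ^ i + e * (har S + recip S), ?_⟩
    rw [pow_succ, h]
    push_cast
    ring

lemma recip_succ {n : ℕ} (hn : 0 < n) :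
    (recip S).1 (n + 1) = (recip S).1 n * (ratio S).1 n := by
  have : (n : ℝ) ≠ 0 := by positivity
  simp only [recip, ratio]
  push_cast
  field_simp

lemma har_succ {n : ℕ} (hn : 0 < n) : (har S).1 (n + 1) = (har S).1 n + (recip S).1 n :=
  psum_succ _ hn

/-- The difference of `n ^ (-j) H_n ^ i`. -/
lemma sub_recip_pow_mul_har_pow (j i : ℕ) {n : ℕ} (hn : 0 < n) :
    (recip S ^ j * har S ^ i).1 (n + 1) - (recip S ^ j * har S ^ i).1 n =
      (recip S ^ j * (ratio S ^ j * (har S + recip S) ^ i - har S ^ i)).1 n := by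
  simp only [Subalgebra.coe_mul, Subalgebra.coe_pow, Subalgebra.coe_sub, Subalgebra.coe_add,
    Pi.mul_apply, Pi.pow_apply, Pi.sub_apply, Pi.add_apply, recip_succ hn, har_succ hn, mul_pow]
  ring

/-- `f` is a difference, up to higher powers of `1 / n`. -/
def IsDiff (S : Subalgebra ℚ ℝ) (j : ℕ) (f : logAlg S) : Prop :=
  ∃ g e : logAlg S, ∀ n, 0 < n → f.1 n = g.1 (n + 1) - g.1 n + (recip S ^ j * e).1 n

lemma IsDiff.add {j : ℕ} {f g : logAlg S} (hf : IsDiff S j f) (hg : IsDiff S j g) :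
    IsDiff S j (f + g) := by
  obtain ⟨u, e, h⟩ := hf
  obtain ⟨u', e', h'⟩ := hg
  refine ⟨u + u', e + e', fun n hn => ?_⟩
  rw [mul_add]
  simp only [Subalgebra.coe_add, Pi.add_apply, h n hn, h' n hn]
  ring

lemma IsDiff.smul {j : ℕ} {f : logAlg S} (c : S) (hf : IsDiff S j f) : IsDiff S j (c • f) := by
  obtain ⟨u, e, h⟩ := hf
  refine ⟨c • u, c • e, fun n hn => ?_⟩
  rw [mul_smul_comm]
  simp only [Subalgebra.coe_smul, Pi.smul_apply, h n hn, smul_add, smul_sub]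

lemma IsDiff.of_mul {j : ℕ} (f : logAlg S) : IsDiff S j (recip S ^ j * f) :=
  ⟨0, f, fun n _ => by simp⟩

lemma isDiff_recip_pow_mul_har_pow (j i : ℕ) :
    IsDiff S (j + 3) (recip S ^ (j + 2) * har S ^ i) := by
  have hc : ∀ f : logAlg S, IsDiff S (j + 3) (((j : logAlg S) + 1) * f) →
      IsDiff S (j + 3) f := by
    intro f hf
    have hj : ((j : ℚ) + 1) ≠ 0 := by positivity
    have := hf.smul (algebraMap ℚ S ((j : ℚ) + 1)⁻¹)
    convert this using 1
    refine Subtype.ext (funext fun n => ?_)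
    have hj' : ((j : ℝ) + 1) ≠ 0 := by positivity
    have e : (algebraMap ℚ S ((j : ℚ) + 1)⁻¹ : S) • f.1 n * (1 : ℝ) = ((j : ℝ) + 1)⁻¹ * f.1 n := by
      rw [mul_one, Algebra.smul_def]
      congr 1
      change ((((j : ℚ) + 1)⁻¹ : ℚ) : ℝ) = _
      push_cast
      rfl
    rw [mul_one] at e
    simp only [Subalgebra.coe_smul, Pi.smul_apply, Subalgebra.coe_mul, Pi.mul_apply,
      Subalgebra.coe_add, Subalgebra.coe_one, Pi.add_apply,
      Pi.one_apply] at e ⊢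
    have hn : (j : logAlg S).1 n = (j : ℝ) := rfl
    rw [← mul_smul_comm, e, hn]
    field_simp
  obtain ⟨e, he⟩ := exists_ratio_pow_eq (S := S) (j + 1)
  induction i with
  | zero =>
    refine hc _ ⟨-recip S ^ (j + 1), e, fun n hn => ?_⟩
    have := sub_recip_pow_mul_har_pow (S := S) (j + 1) 0 hn
    simp only [pow_zero, mul_one] at this
    have e' : ((j : logAlg S) + 1) * (recip S ^ (j + 2) * har S ^ 0) = recip S ^ (j + 3) * e -
        recip S ^ (j + 1) * (ratio S ^ (j + 1) - 1) := by
      rw [he]; push_cast; ring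
    rw [e', Subalgebra.coe_sub, Pi.sub_apply, ← this]
    simp only [Subalgebra.coe_neg, Pi.neg_apply]
    ring
  | succ i ih =>
    obtain ⟨f, hf⟩ := exists_har_add_pow_eq (S := S) i
    have h₁ : IsDiff S (j + 3) (-(recip S ^ (j + 1) *
        (ratio S ^ (j + 1) * (har S + recip S) ^ (i + 1) - har S ^ (i + 1)))) := by
      refine ⟨-(recip S ^ (j + 1) * har S ^ (i + 1)), 0, fun n hn => ?_⟩
      have := sub_recip_pow_mul_har_pow (S := S) (j + 1) (i + 1) hn
      simp only [Subalgebra.coe_neg, Pi.neg_apply, ← this]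
      simp
      ring
    have h₂ := ih.smul ((i : S) + 1)
    have h₃ := IsDiff.of_mul (j := j + 3) ((1 - ((j : logAlg S) + 1) * recip S) * f +
      e * (har S + recip S) ^ (i + 1) - ((j : logAlg S) + 1) * ((i : logAlg S) + 1) * har S ^ i)
    refine hc _ ?_
    convert (h₁.add h₂).add h₃ using 1
    rw [he]
    have e₁ : ((i : S) + 1) • (recip S ^ (j + 2) * har S ^ i) =
        ((i : logAlg S) + 1) * (recip S ^ (j + 2) * har S ^ i) := by
      rw [Algebra.smul_def, map_add, map_natCast, map_one]
    rw [e₁]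
    push_cast
    linear_combination recip S ^ (j + 1) * (1 - ((j : logAlg S) + 1) * recip S) * hf

lemma isDiff_recip_pow_mul (j : ℕ) (e : logAlg S) : IsDiff S (j + 3) (recip S ^ (j + 2) * e) := by
  obtain ⟨p, f, rfl⟩ := exists_eq_aeval_add e
  have h : IsDiff S (j + 3) (recip S ^ (j + 2) * aeval (har S) p) := by
    induction p using Polynomial.induction_on' with
    | add p q hp hq => rw [map_add, mul_add]; exact hp.add hq
    | monomial i c =>
      have := (isDiff_recip_pow_mul_har_pow (S := S) j i).smul c
      rwa [aeval_monomial, ← Algebra.smul_def, mul_smul_comm]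
  have h' := IsDiff.of_mul (j := j + 3) f
  convert h.add h' using 1
  ring

/-- Multiples of `n ^ (-2)` are differences up to any power of `1 / n`. -/
lemma isDiff_recip_sq_mul (j : ℕ) (e : logAlg S) : IsDiff S (j + 2) (recip S ^ 2 * e) := by
  induction j with
  | zero => exact .of_mul e
  | succ j ih =>
    obtain ⟨g, f, h⟩ := ih
    obtain ⟨g', f', h'⟩ := isDiff_recip_pow_mul j f
    refine ⟨g + g', f', fun n hn => ?_⟩
    rw [h n hn, h' n hn]
    simp only [Subalgebra.coe_add, Pi.add_apply]
    ring

end logAlg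

end LogAlg

section Expansion

open Filter Topology Asymptotics Polynomial

lemma harm_succ (n : ℕ) : harm (n + 1) = (harmonic n : ℝ) := by
  simp [harm, psum, harmonic, Finset.sum_Ico_eq_sum_range, add_comm]

lemma tendsto_harm : Tendsto harm atTop atTop := by
  rw [← tendsto_add_atTop_iff_nat 1]
  refine tendsto_atTop_mono (fun n => ?_)
    (Real.tendsto_log_atTop.comp (tendsto_natCast_atTop_atTop.comp (tendsto_add_atTop_nat 1)))
  rw [harm_succ]
  simpa using log_add_one_le_harmonic n

/-- `f` grows slower than every power of `n`. -/
def SubPow (f : ℕ → ℝ) : Prop :=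
  ∀ ε : ℝ, 0 < ε → f =O[atTop] fun n : ℕ => (n : ℝ) ^ ε

lemma SubPow.mul {f g : ℕ → ℝ} (hf : SubPow f) (hg : SubPow g) : SubPow (f * g) := by
  intro ε hε
  refine ((hf (ε / 2) (by positivity)).mul (hg (ε / 2) (by positivity))).congr_right fun n => ?_
  rw [← Real.rpow_add_of_nonneg (by positivity) (by positivity) (by positivity), add_halves]

lemma subPow_of_isBigO_one {f : ℕ → ℝ} (hf : f =O[atTop] fun _ => (1 : ℝ)) : SubPow f := by
  intro ε hε
  refine hf.trans (IsBigO.of_bound 1 ?_)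
  filter_upwards [eventually_ge_atTop 1] with n hn
  have : (1 : ℝ) ≤ (n : ℝ) ^ ε := Real.one_le_rpow (by exact_mod_cast hn) hε.le
  rw [norm_one, one_mul]
  exact this.trans (le_abs_self _)

lemma subPow_harm : SubPow harm := by
  intro ε hε
  have h₁ : (fun n : ℕ => 1 + Real.log n) =O[atTop] fun n : ℕ => (n : ℝ) ^ ε :=
    (subPow_of_isBigO_one (isBigO_refl _ _) ε hε).add
      ((isLittleO_log_rpow_atTop hε).isBigO.comp_tendsto tendsto_natCast_atTop_atTop)
  refine IsBigO.trans (IsBigO.of_bound 1 ?_) h₁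
  filter_upwards [eventually_ge_atTop 2] with n hn
  obtain ⟨n, rfl⟩ : ∃ m, n = m + 1 := ⟨n - 1, by omega⟩
  have h := harmonic_le_one_add_log n
  have h' : Real.log n ≤ Real.log ((n + 1 : ℕ) : ℝ) :=
    Real.log_le_log (by norm_cast; omega) (by push_cast; linarith)
  have h₀ : (0 : ℝ) ≤ harmonic n := by
    rw [← harm_succ]
    exact Finset.sum_nonneg (s := Ico 1 (n + 1)) (f := fun m : ℕ => (m : ℝ)⁻¹)
      fun _ _ => by positivity
  rw [harm_succ, one_mul, Real.norm_of_nonneg h₀]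
  exact (h.trans (by linarith)).trans (le_abs_self _)

variable {S : Subalgebra ℚ ℝ}

lemma subPow_of_mem_logAlg {e : ℕ → ℝ} (he : e ∈ logAlg S) : SubPow e := by
  induction he using Algebra.adjoin_induction with
  | mem e he =>
    have hx : ∀ n : ℕ, 0 ≤ (n : ℝ)⁻¹ ∧ (n : ℝ)⁻¹ ≤ 1 := fun n =>
      ⟨by positivity, Nat.cast_inv_le_one n⟩
    obtain rfl | rfl | rfl := he
    · refine subPow_of_isBigO_one (IsBigO.of_bound 1 (.of_forall fun n => ?_))
      simpa [abs_of_nonneg] using (hx n).2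
    · exact subPow_harm
    · refine subPow_of_isBigO_one (IsBigO.of_bound 1 (.of_forall fun n => ?_))
      rw [Real.norm_of_nonneg (by have := (hx n).1; positivity)]
      simpa using inv_le_one_of_one_le₀ (by have := (hx n).1; linarith)
  | algebraMap c => exact subPow_of_isBigO_one (isBigO_const_const _ one_ne_zero _)
  | add e e' he he' h h' => exact fun ε hε => (h ε hε).add (h' ε hε)
  | mul e e' he he' h h' => exact h.mul h'

lemma SubPow.isBigO_natCast {f : ℕ → ℝ} (hf : SubPow f) : f =O[atTop] fun n : ℕ => (n : ℝ) := by
  simpa using hf 1 one_pos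

lemma SubPow.tendsto_inv_mul {f : ℕ → ℝ} (hf : SubPow f) :
    Tendsto (fun n : ℕ => (n : ℝ)⁻¹ * f n) atTop (𝓝 0) := by
  have h₁ : (fun n : ℕ => (n : ℝ)⁻¹ * f n) =O[atTop] fun n : ℕ => (n : ℝ) ^ (-(1 / 2) : ℝ) := by
    refine ((isBigO_refl (fun n : ℕ => (n : ℝ)⁻¹) _).mul (hf (1 / 2) (by norm_num))).congr'
      .rfl ?_
    filter_upwards [eventually_gt_atTop 0] with n hn
    have hn' : (0 : ℝ) < n := by exact_mod_cast hn
    rw [← Real.rpow_neg_one, ← Real.rpow_add hn']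
    norm_num
  exact h₁.trans_tendsto ((tendsto_rpow_neg_atTop (by norm_num)).comp tendsto_natCast_atTop_atTop)

namespace logAlg

lemma coe_aeval_har (p : S[X]) (n : ℕ) :
    (aeval (har S) p).1 n = (p.map (algebraMap S ℝ)).eval (harm n) := by
  induction p using Polynomial.induction_on' with
  | add p q hp hq => simp [map_add, hp, hq, Polynomial.map_add, eval_add]
  | monomial i c =>
    rw [aeval_monomial, Polynomial.map_monomial, eval_monomial]
    rfl

/-- An element of `logAlg S` with a limit is constant modulo `1 / n`. -/
lemma exists_eq_of_tendsto (e : logAlg S) {L : ℝ} (h : Tendsto e.1 atTop (𝓝 L)) :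
    ∃ (c : S) (f : logAlg S), (c : ℝ) = L ∧ ∀ n, e.1 n = L + (n : ℝ)⁻¹ * f.1 n := by
  obtain ⟨p, f, rfl⟩ := exists_eq_aeval_add e
  have hf := (subPow_of_mem_logAlg f.2).tendsto_inv_mul
  have hp : Tendsto (fun n => (p.map (algebraMap S ℝ)).eval (harm n)) atTop (𝓝 L) := by
    have := h.sub hf
    rw [sub_zero] at this
    refine this.congr fun n => ?_
    rw [← coe_aeval_har]
    simp [recip]
  have hdeg : (p.map (algebraMap S ℝ)).degree ≤ 0 := by
    by_contra! hd
    have := (Polynomial.abs_tendsto_atTop _ hd).comp tendsto_harm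
    exact not_tendsto_nhds_of_tendsto_atTop this _ hp.abs
  rw [degree_map_eq_of_injective Subtype.val_injective] at hdeg
  rw [eq_C_of_degree_le_zero hdeg] at hp ⊢
  simp only [map_C, eval_C] at hp
  refine ⟨p.coeff 0, f, tendsto_nhds_unique tendsto_const_nhds hp, fun n => ?_⟩
  rw [tendsto_nhds_unique hp tendsto_const_nhds, Subalgebra.coe_add, Pi.add_apply, coe_aeval_har,
    map_C, eval_C]
  rfl

lemma mem_of_tendsto (P : ℕ) {L : ℝ} : ∀ e : logAlg S,
    Tendsto (fun n : ℕ => (n : ℝ) ^ P * e.1 n) atTop (𝓝 L) → L ∈ S := by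
  induction P with
  | zero =>
    intro e h
    obtain ⟨c, -, rfl, -⟩ := exists_eq_of_tendsto e (by simpa using h)
    exact c.2
  | succ P ih =>
    intro e h
    have h₀ : Tendsto e.1 atTop (𝓝 0) := by
      have := (tendsto_inv_atTop_nhds_zero_nat (𝕜 := ℝ)).pow (P + 1) |>.mul h
      rw [zero_pow P.succ_ne_zero, zero_mul] at this
      refine this.congr' ?_
      filter_upwards [eventually_gt_atTop 0] with n hn
      have : (n : ℝ) ≠ 0 := by positivity
      rw [← mul_assoc, ← mul_pow, inv_mul_cancel₀ this, one_pow, one_mul]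
    obtain ⟨-, f, -, hf⟩ := exists_eq_of_tendsto e h₀
    refine ih f (h.congr' ?_)
    filter_upwards [eventually_gt_atTop 0] with n hn
    have : (n : ℝ) ≠ 0 := by positivity
    rw [hf, pow_succ]
    field_simp
    ring

end logAlg

/-- If the increments of `y` are `O(1 / n ^ (K + 2))` then `y` converges, with an error
`O(1 / n ^ K)`. -/
lemma exists_isBigO_sub_of_increments {y : ℕ → ℝ} {K : ℕ}
    (h : (fun n => y (n + 1) - y n) =O[atTop] fun n : ℕ => ((n : ℝ)⁻¹) ^ (K + 2)) :
    ∃ c, Tendsto y atTop (𝓝 c) ∧ (fun n => y n - c) =O[atTop] fun n : ℕ => ((n : ℝ)⁻¹) ^ K := by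
  obtain ⟨C, hC, h⟩ := h.exists_pos
  obtain ⟨N, hN⟩ := eventually_atTop.1 (h.bound.and (eventually_gt_atTop 0))
  have hs : Summable fun i : ℕ => C * (((i + 1 : ℕ) : ℝ) ^ 2)⁻¹ :=
    ((summable_nat_add_iff 1).2 (Real.summable_nat_pow_inv.2 one_lt_two)).mul_left C
  have hd : ∀ n, N ≤ n → ∀ i, dist (y (n + i)) (y (n + (i + 1))) ≤
      (n : ℝ)⁻¹ ^ K * (C * (((i + 1 : ℕ) : ℝ) ^ 2)⁻¹) := by
    intro n hn i
    obtain ⟨h₁, -⟩ := hN (n + i) (by omega)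
    have hn' : 0 < n := (hN n hn).2
    rw [dist_comm, Real.dist_eq, ← Real.norm_eq_abs, ← add_assoc]
    refine h₁.trans ?_
    rw [Real.norm_of_nonneg (by positivity), pow_add, mul_left_comm, ← inv_pow]
    have hinv : ∀ a b : ℕ, 0 < a → a ≤ b → (b : ℝ)⁻¹ ≤ (a : ℝ)⁻¹ := fun a b ha hab =>
      inv_anti₀ (by exact_mod_cast ha) (by exact_mod_cast hab)
    have h₂ := pow_le_pow_left₀ (by positivity) (hinv n (n + i) hn' (by omega)) K
    have h₃ := pow_le_pow_left₀ (by positivity) (hinv (i + 1) (n + i) (by omega) (by omega)) 2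
    exact mul_le_mul h₂ (mul_le_mul_of_nonneg_left h₃ hC.le) (by positivity) (by positivity)
  have hlim : ∃ c, Tendsto y atTop (𝓝 c) := by
    have := cauchySeq_of_dist_le_of_summable _ (hd N le_rfl) (hs.mul_left _)
    obtain ⟨c, hc⟩ := cauchySeq_tendsto_of_complete this
    refine ⟨c, (tendsto_add_atTop_iff_nat N).1 (hc.congr fun i => by rw [add_comm])⟩
  obtain ⟨c, hc⟩ := hlim
  refine ⟨c, hc, IsBigO.of_bound (∑' i : ℕ, C * (((i + 1 : ℕ) : ℝ) ^ 2)⁻¹) ?_⟩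
  filter_upwards [eventually_ge_atTop N] with n hn
  have hc' : Tendsto (fun i => y (n + i)) atTop (𝓝 c) :=
    ((tendsto_add_atTop_iff_nat n).2 hc).congr fun i => by rw [add_comm]
  have := dist_le_tsum_of_dist_le_of_tendsto₀ _ (hd n hn) (hs.mul_left _) hc'
  rw [tsum_mul_left, add_zero, Real.dist_eq] at this
  rw [Real.norm_of_nonneg (by positivity : (0 : ℝ) ≤ (n : ℝ)⁻¹ ^ K), mul_comm]
  exact this

/-- `f` has an asymptotic expansion in powers of `1 / n` and harmonic numbers. -/
def Expands (S : Subalgebra ℚ ℝ) (f : ℕ → ℝ) : Prop :=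
  ∀ K : ℕ, ∃ e ∈ logAlg S, (fun n => f n - e n) =O[atTop] fun n : ℕ => ((n : ℝ)⁻¹) ^ K

lemma Expands.of_mem {e : ℕ → ℝ} (he : e ∈ logAlg S) : Expands S e :=
  fun _ => ⟨e, he, by simpa using isBigO_zero _ _⟩

lemma Expands.add {f g : ℕ → ℝ} (hf : Expands S f) (hg : Expands S g) : Expands S (f + g) := by
  intro K
  obtain ⟨e, he, h⟩ := hf K
  obtain ⟨e', he', h'⟩ := hg K
  refine ⟨e + e', add_mem he he', (h.add h').congr_left fun n => ?_⟩
  simp only [Pi.add_apply]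
  ring

lemma Expands.isBigO {f : ℕ → ℝ} (hf : Expands S f) : f =O[atTop] fun n : ℕ => (n : ℝ) := by
  obtain ⟨e, he, h⟩ := hf 0
  simp only [pow_zero] at h
  exact ((subPow_of_isBigO_one h).isBigO_natCast.add
    (subPow_of_mem_logAlg he).isBigO_natCast).congr_left fun n => by ring

lemma isBigO_pow_mul_cast {f g : ℕ → ℝ} {K : ℕ}
    (hf : f =O[atTop] fun n : ℕ => ((n : ℝ)⁻¹) ^ (K + 1)) (hg : g =O[atTop] fun n : ℕ => (n : ℝ)) :
    (fun n => f n * g n) =O[atTop] fun n : ℕ => ((n : ℝ)⁻¹) ^ K := by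
  refine (hf.mul hg).congr' .rfl ?_
  filter_upwards [eventually_gt_atTop 0] with n hn
  have : (n : ℝ) ≠ 0 := by positivity
  rw [pow_succ, mul_assoc, inv_mul_cancel₀ this, mul_one]

lemma Expands.mul {f g : ℕ → ℝ} (hf : Expands S f) (hg : Expands S g) : Expands S (f * g) := by
  intro K
  obtain ⟨e, he, h⟩ := hf (K + 1)
  obtain ⟨e', he', h'⟩ := hg (K + 1)
  refine ⟨e * e', mul_mem he he', ((isBigO_pow_mul_cast h hg.isBigO).add
    (isBigO_pow_mul_cast h' (subPow_of_mem_logAlg he).isBigO_natCast)).congr_left fun n => ?_⟩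
  simp only [Pi.mul_apply]
  ring

lemma Expands.smul {f : ℕ → ℝ} (hf : Expands S f) {c : ℝ} (hc : c ∈ S) :
    Expands S (fun n => c * f n) :=
  Expands.mul (.of_mem ((logAlg S).algebraMap_mem ⟨c, hc⟩)) hf

lemma Expands.psum_pow_mul {g : ℕ → ℝ} (hg : Expands S g) (k : ℕ) {c : ℝ} (hc : c ∈ S)
    (hlim : Tendsto (psum fun m => (m : ℝ)⁻¹ ^ (k + 2) * g m) atTop (𝓝 c)) :
    Expands S (psum fun m => (m : ℝ)⁻¹ ^ (k + 2) * g m) := by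
  intro K
  obtain ⟨e, he, h⟩ := hg K
  obtain ⟨G, e', hG⟩ := logAlg.isDiff_recip_sq_mul (K + 1)
    (logAlg.recip S ^ k * (⟨e, he⟩ : logAlg S))
  obtain ⟨c', hc', hy⟩ := exists_isBigO_sub_of_increments (K := K)
    (y := fun n => psum (fun m => (m : ℝ)⁻¹ ^ (k + 2) * g m) n - G.1 n) (by
      have h₁ : (fun n : ℕ => (n : ℝ)⁻¹ ^ (k + 2) * (g n - e n)) =O[atTop]
          fun n : ℕ => ((n : ℝ)⁻¹) ^ (K + 2) := by
        refine IsBigO.trans ?_ (((isBigO_refl (fun n : ℕ => (n : ℝ)⁻¹ ^ 2) _).mul h).congr_right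
          fun n => by ring)
        refine IsBigO.mul (IsBigO.of_bound 1 (.of_forall fun n => ?_)) (isBigO_refl _ _)
        rw [Real.norm_of_nonneg (by positivity), Real.norm_of_nonneg (by positivity), one_mul]
        exact pow_le_pow_of_le_one (by positivity) (Nat.cast_inv_le_one n) (by omega)
      have h₂ : (fun n : ℕ => (n : ℝ)⁻¹ ^ (K + 3) * e'.1 n) =O[atTop]
          fun n : ℕ => ((n : ℝ)⁻¹) ^ (K + 2) :=
        isBigO_pow_mul_cast (isBigO_refl _ _) (subPow_of_mem_logAlg e'.2).isBigO_natCast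
      refine (h₁.add h₂).congr' ?_ .rfl
      filter_upwards [eventually_gt_atTop 0] with n hn
      have := hG n hn
      simp only [Subalgebra.coe_mul, Subalgebra.coe_pow, logAlg.recip, Pi.mul_apply,
        Pi.pow_apply] at this
      rw [psum_succ _ hn]
      linear_combination -this)
  have hc'' : c - c' ∈ S := logAlg.mem_of_tendsto 0 G
    ((hlim.sub hc').congr fun n => by simp)
  have hcS : c' ∈ S := by simpa using sub_mem hc hc''
  refine ⟨G.1 + fun _ => c', add_mem G.2 ((logAlg S).algebraMap_mem ⟨c', hcS⟩),
    hy.congr_left fun n => ?_⟩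
  simp only [Pi.add_apply]
  ring

end Expansion

section Words

open Filter Topology

/-- The operator sending `f` to the partial sums of `f m / m ^ (k + 1)`. -/
noncomputable def zsum (k : ℕ) : (ℕ → ℝ) →ₗ[ℝ] ℕ → ℝ where
  toFun f := psum fun m => (m : ℝ)⁻¹ ^ (k + 1) * f m
  map_add' f g := by
    funext n
    simp only [Pi.add_apply, mul_add, psum_add]
  map_smul' c f := by
    funext n
    simp only [Pi.smul_apply, smul_eq_mul, RingHom.id_apply, mul_left_comm _ c, psum_mul_left]

lemma zsum_apply (k : ℕ) (f : ℕ → ℝ) :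
    zsum k f = psum fun m => (m : ℝ)⁻¹ ^ (k + 1) * f m := rfl

lemma zsum_zero_one : zsum 0 1 = harm := by simp [zsum_apply, harm]

/-- Rational combinations of multiple harmonic sums of depth at most `d`. -/
inductive HarmonicSum : ℕ → (ℕ → ℝ) → Prop
  | one (d : ℕ) : HarmonicSum d 1
  | sum {d : ℕ} {f : ℕ → ℝ} (k : ℕ) (hf : HarmonicSum d f) : HarmonicSum (d + 1) (zsum k f)
  | add {d : ℕ} {f g : ℕ → ℝ} (hf : HarmonicSum d f) (hg : HarmonicSum d g) : HarmonicSum d (f + g)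
  | smul {d : ℕ} {f : ℕ → ℝ} (c : ℚ) (hf : HarmonicSum d f) : HarmonicSum d ((c : ℝ) • f)

lemma HarmonicSum.succ {d : ℕ} {f : ℕ → ℝ} (hf : HarmonicSum d f) : HarmonicSum (d + 1) f := by
  induction hf with
  | one d => exact .one _
  | sum k _ ih => exact .sum k ih
  | add _ _ hf hg => exact hf.add hg
  | smul c _ hf => exact hf.smul c

lemma harm_mul_zsum (k : ℕ) (f : ℕ → ℝ) :
    harm * zsum k f = zsum 0 (zsum k f) + zsum k (harm * f) + zsum (k + 1) f := by
  funext n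
  simp only [Pi.mul_apply, Pi.add_apply, zsum_apply, harm, psum_mul_psum]
  congr 1
  · congr 1
    · exact psum_congr fun m _ _ => by rw [zero_add, pow_one]
    · exact psum_congr fun m _ _ => by ring
  · exact psum_congr fun m _ _ => by ring

lemma HarmonicSum.harm_mul {d : ℕ} {f : ℕ → ℝ} (hf : HarmonicSum d f) :
    HarmonicSum (d + 1) (harm * f) := by
  induction hf with
  | one d => rw [mul_one, ← zsum_zero_one]; exact .sum 0 (.one d)
  | sum k hf ih =>
    rw [harm_mul_zsum]
    exact ((HarmonicSum.sum 0 (.sum k hf)).add (.sum k ih)).add (HarmonicSum.sum (k + 1) hf).succ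
  | add _ _ hf hg => rw [mul_add]; exact hf.add hg
  | smul c _ hf => rw [mul_smul_comm]; exact hf.smul c

lemma HarmonicSum.zsum_pow {d : ℕ} {f : ℕ → ℝ} (hf : HarmonicSum d f) (a : ℕ) :
    HarmonicSum (a + d) ((zsum 0 ^ a) f) := by
  induction a with
  | zero => simpa using hf
  | succ a ih =>
    rw [pow_succ', Module.End.mul_apply, add_right_comm]
    exact ih.sum 0

/-- The terms other than `(a + 1) • zsum 0 ^ (a + 1) β` in the product of `harm` and
`zsum 0 ^ a β`. -/
noncomputable def shuffleRem (β : ℕ → ℝ) : ℕ → ℕ → ℝ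
  | 0 => harm * β - zsum 0 β
  | a + 1 => zsum 0 (shuffleRem β a) + zsum 1 ((zsum 0 ^ a) β)

lemma harm_mul_zsum_pow (β : ℕ → ℝ) (a : ℕ) :
    harm * (zsum 0 ^ a) β = ((a : ℝ) + 1) • (zsum 0 ^ (a + 1)) β + shuffleRem β a := by
  induction a with
  | zero => simp [shuffleRem]
  | succ a ih =>
    rw [pow_succ', Module.End.mul_apply, harm_mul_zsum, ih, shuffleRem, map_add, map_smul,
      pow_succ' _ (a + 1), Module.End.mul_apply, pow_succ' _ a, Module.End.mul_apply]
    push_cast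
    module

variable {S : Subalgebra ℚ ℝ}

lemma Expands.ratCast_smul {f : ℕ → ℝ} (hf : Expands S f) (c : ℚ) : Expands S ((c : ℝ) • f) :=
  hf.smul (S.algebraMap_mem c)

lemma expands_harm : Expands S harm := .of_mem (logAlg.har S).2

lemma Expands.zsum_pow_succ {β : ℕ → ℝ} {N : ℕ}
    (h₀ : ∀ b ≤ N, Expands S ((zsum 0 ^ b) (harm * β - zsum 0 β)))
    (h₁ : ∀ a b, a + b + 1 ≤ N → Expands S ((zsum 0 ^ b) (zsum 1 ((zsum 0 ^ a) β))))
    (h : Expands S ((zsum 0 ^ N) β)) : Expands S ((zsum 0 ^ (N + 1)) β) := by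
  have hr : ∀ a b, a + b ≤ N → Expands S ((zsum 0 ^ b) (shuffleRem β a)) := by
    intro a
    induction a with
    | zero => exact fun b hb => h₀ b (by omega)
    | succ a ih =>
      intro b hb
      have := ih (b + 1) (by omega)
      rw [shuffleRem, map_add]
      rw [pow_succ, Module.End.mul_apply] at this
      exact this.add (h₁ a b (by omega))
  have h₂ : (zsum 0 ^ (N + 1)) β = (((N + 1 : ℚ)⁻¹ : ℚ) : ℝ) •
      (harm * (zsum 0 ^ N) β + ((-1 : ℚ) : ℝ) • shuffleRem β N) := by
    rw [harm_mul_zsum_pow]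
    have : (N : ℝ) + 1 ≠ 0 := by positivity
    push_cast
    match_scalars <;> field_simp
    ring
  rw [h₂]
  exact ((expands_harm.mul h).add ((hr N 0 le_rfl).ratCast_smul _)).ratCast_smul _

/-- Multiple harmonic sums have asymptotic expansions, provided that `S` contains the limits of
those which converge. -/
theorem HarmonicSum.expands
    (hS : ∀ d f k, HarmonicSum d f → ∃ c ∈ S, Tendsto (zsum (k + 1) f) atTop (𝓝 c))
    {d : ℕ} {f : ℕ → ℝ} (hf : HarmonicSum d f) : Expands S f := by
  induction d using Nat.strong_induction_on generalizing f with
  | _ D ihD =>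
  have h₁ : ∀ a e h k, HarmonicSum e h → a + e < D →
      Expands S ((zsum 0 ^ a) (zsum (k + 1) h)) := by
    intro a
    induction a using Nat.strong_induction_on with
    | _ a iha =>
    intro e h k hh hD
    obtain _ | a := a
    · obtain ⟨c, hc, hlim⟩ := hS e h k hh
      exact (ihD e (by omega) hh).psum_pow_mul k hc hlim
    · refine Expands.zsum_pow_succ (fun b hb => ?_) (fun a' b hb => ?_)
        (iha a (by omega) e h k hh (by omega))
      · rw [harm_mul_zsum, add_sub_right_comm, add_sub_cancel_left, map_add]
        exact (iha b (by omega) (e + 1) _ k hh.harm_mul (by omega)).add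
          (iha b (by omega) e h (k + 1) hh (by omega))
      · exact iha b (by omega) _ _ 0 ((hh.sum (k + 1)).zsum_pow a') (by omega)
  have h₂ : ∀ a, a ≤ D → Expands S ((zsum 0 ^ a) 1) := by
    intro a
    induction a with
    | zero => exact fun _ => .of_mem (one_mem _)
    | succ a iha =>
      refine fun ha => Expands.zsum_pow_succ (fun b hb => ?_) (fun a' b hb => ?_) (iha (by omega))
      · rw [mul_one, zsum_zero_one, sub_self, map_zero]
        exact .of_mem (zero_mem _)
      · exact h₁ b _ _ 0 ((HarmonicSum.one 0).zsum_pow a') (by omega)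
  have h₃ : ∀ e h, HarmonicSum e h → ∀ b, b + e ≤ D → Expands S ((zsum 0 ^ b) h) := by
    intro e h hh
    induction hh with
    | one d => exact fun b hb => h₂ b (by omega)
    | sum k hf ih =>
      intro b hb
      obtain _ | k := k
      · have := ih (b + 1) (by omega)
        rwa [pow_succ, Module.End.mul_apply] at this
      · exact h₁ b _ _ k hf (by omega)
    | add _ _ hf hg =>
      intro b hb
      rw [map_add]
      exact (hf b hb).add (hg b hb)
    | smul c _ hf =>
      intro b hb
      rw [map_smul]
      exact (hf b hb).ratCast_smul c
  simpa using h₃ D f hf 0 (by omega)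

end Words

section Laurent

open Filter Topology Asymptotics

/-- Combinations of multiple harmonic sums with powers of `n` as coefficients. -/
inductive LaurentSum : (ℕ → ℝ) → Prop
  | mk (p : ℤ) {d : ℕ} {g : ℕ → ℝ} (hg : HarmonicSum d g) :
      LaurentSum fun n => (n : ℝ) ^ p * g n
  | add {f g : ℕ → ℝ} (hf : LaurentSum f) (hg : LaurentSum g) : LaurentSum (f + g)
  | congr {f g : ℕ → ℝ} (h : ∀ n, 0 < n → f n = g n) (hf : LaurentSum f) : LaurentSum g

namespace LaurentSum

lemma of_harmonicSum {d : ℕ} {g : ℕ → ℝ} (hg : HarmonicSum d g) : LaurentSum g :=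
  .congr (fun n _ => by simp) (.mk 0 hg)

lemma zero : LaurentSum 0 := .congr (fun n _ => by simp) (.mk 0 ((HarmonicSum.one 0).smul 0))

lemma zpow_mul (q : ℤ) {f : ℕ → ℝ} (hf : LaurentSum f) :
    LaurentSum fun n => (n : ℝ) ^ q * f n := by
  induction hf with
  | mk p hg =>
    refine .congr (fun n hn => ?_) (.mk (q + p) hg)
    have : (n : ℝ) ≠ 0 := by positivity
    rw [zpow_add₀ this, mul_assoc]
  | add _ _ hf hg => exact .congr (fun n _ => (mul_add _ _ _).symm) (hf.add hg)
  | congr h _ ih => exact .congr (fun n hn => by rw [h n hn]) ih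

lemma smul (c : ℚ) {f : ℕ → ℝ} (hf : LaurentSum f) : LaurentSum fun n => (c : ℝ) * f n := by
  induction hf with
  | mk p hg => exact .congr (fun n hn => mul_left_comm _ _ _) (.mk p (hg.smul c))
  | add _ _ hf hg => exact .congr (fun n _ => (mul_add _ _ _).symm) (hf.add hg)
  | congr h _ ih => exact .congr (fun n hn => by rw [h n hn]) ih

lemma neg {f : ℕ → ℝ} (hf : LaurentSum f) : LaurentSum (-f) :=
  .congr (fun n _ => by simp) (hf.smul (-1))

lemma sub {f g : ℕ → ℝ} (hf : LaurentSum f) (hg : LaurentSum g) : LaurentSum (f - g) :=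
  sub_eq_add_neg f g ▸ hf.add hg.neg

lemma finsetSum {ι : Type} (s : Finset ι) {f : ι → ℕ → ℝ} (h : ∀ i ∈ s, LaurentSum (f i)) :
    LaurentSum fun n => ∑ i ∈ s, f i n := by
  classical
  induction s using Finset.induction_on with
  | empty => exact .congr (fun n _ => by simp) zero
  | insert i s hi ih =>
    refine .congr (fun n _ => by rw [Finset.sum_insert hi]; rfl)
      ((h i (Finset.mem_insert_self i s)).add (ih fun j hj => h j (Finset.mem_insert_of_mem hj)))

end LaurentSum

lemma psum_finsetSum {ι : Type} (s : Finset ι) (f : ι → ℕ → ℝ) (n : ℕ) :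
    psum (fun m => ∑ i ∈ s, f i m) n = ∑ i ∈ s, psum (f i) n :=
  Finset.sum_comm

/-- Summation by parts. -/
lemma psum_sub_mul (B g : ℕ → ℝ) {n : ℕ} (hn : 0 < n) :
    psum (fun m => (B (m + 1) - B m) * g m) n =
      B n * g n - B 1 * g 1 - psum (fun m => B (m + 1) * (g (m + 1) - g m)) n := by
  induction n, hn using Nat.le_induction with
  | base => simp
  | succ n hn ih =>
    rw [psum_succ _ hn, psum_succ _ hn, ih]
    ring

namespace LaurentSum

lemma psum_pow_mul {g : ℕ → ℝ} (hg : LaurentSum g) {c : ℚ} (hc : g 1 = c)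
    (hd : ∀ p : ℕ, LaurentSum (psum fun m => ((m : ℝ) + 1) ^ (p + 1) * (g (m + 1) - g m))) (p : ℕ) :
    LaurentSum (psum fun m => (m : ℝ) ^ p * g m) := by
  induction p using Nat.strong_induction_on with
  | _ p ih =>
  have h₁ := ((hg.zpow_mul (p + 1)).sub (.smul c (.of_harmonicSum (.one 0)))).sub (hd p)
  have h₂ := finsetSum (Finset.range p) fun i hi =>
    (ih i (Finset.mem_range.1 hi)).smul ((p + 1).choose i)
  refine .congr (fun n hn => ?_) ((h₁.sub h₂).smul ((p : ℚ) + 1)⁻¹)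
  have h₃ := psum_sub_mul (fun m => (m : ℝ) ^ (p + 1)) g hn
  have h₄ : psum (fun m => (((m + 1 : ℕ) : ℝ) ^ (p + 1) - (m : ℝ) ^ (p + 1)) * g m) n =
      ∑ i ∈ Finset.range p, ((p + 1).choose i : ℝ) * psum (fun m => (m : ℝ) ^ i * g m) n +
        (p + 1) * psum (fun m => (m : ℝ) ^ p * g m) n := by
    simp only [← psum_mul_left]
    rw [← psum_finsetSum, ← psum_add]
    refine psum_congr fun m _ _ => ?_
    push_cast
    rw [add_pow, Finset.sum_range_succ, Finset.sum_range_succ, Nat.choose_succ_self_right]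
    simp only [one_pow, mul_one, Nat.choose_self, Nat.cast_one, add_sub_cancel_right, add_mul,
      Finset.sum_mul]
    push_cast
    congr 1
    · exact Finset.sum_congr rfl fun i _ => by ring
    · ring
  have hp : (p : ℝ) + 1 ≠ 0 := by positivity
  have hz : (n : ℝ) ^ ((p : ℤ) + 1) = (n : ℝ) ^ (p + 1) := by norm_cast
  rw [h₄] at h₃
  simp only [Pi.sub_apply, Pi.one_apply, hz]
  push_cast at h₃ ⊢
  rw [inv_mul_eq_iff_eq_mul₀ hp, ← hc]
  linear_combination -h₃

lemma psum_zpow_mul {d : ℕ} {g : ℕ → ℝ} (hg : HarmonicSum d g)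
    (h : ∀ p : ℕ, LaurentSum (psum fun m => (m : ℝ) ^ p * g m)) (q : ℤ) :
    LaurentSum (psum fun m => (m : ℝ) ^ q * g m) := by
  obtain ⟨p, rfl | rfl⟩ := q.eq_nat_or_neg
  · simpa using h p
  · obtain _ | p := p
    · simpa using h 0
    · refine .congr (fun n _ => ?_) (.of_harmonicSum (hg.sum p))
      simp only [zsum_apply, zpow_neg, zpow_natCast, inv_pow]

end LaurentSum

lemma HarmonicSum.laurentSum_psum {d : ℕ} {g : ℕ → ℝ} (hg : HarmonicSum d g) :
    ∀ p : ℕ, LaurentSum (psum fun m => (m : ℝ) ^ p * g m) := by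
  induction hg with
  | one d =>
    refine LaurentSum.psum_pow_mul (.of_harmonicSum (.one 0)) (c := 1) (by simp) fun p => ?_
    exact .congr (fun n _ => by simp [psum]) .zero
  | @sum d f k hf ih =>
    refine LaurentSum.psum_pow_mul (.of_harmonicSum (hf.sum k)) (c := 0)
      (by simp [zsum_apply]) fun p => ?_
    have h := LaurentSum.finsetSum (Finset.range (p + 1 + 1)) fun i _ =>
      (LaurentSum.psum_zpow_mul hf ih ((i : ℤ) - (k + 1))).smul ((p + 1).choose i)
    refine .congr (fun n _ => ?_) h
    simp only [← psum_mul_left]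
    rw [← psum_finsetSum]
    refine psum_congr fun m hm _ => ?_
    have hm' : (m : ℝ) ≠ 0 := by positivity
    rw [zsum_apply, psum_succ _ hm, add_sub_cancel_left, add_pow, Finset.sum_mul]
    refine Finset.sum_congr rfl fun i _ => ?_
    rw [zpow_sub₀ hm']
    have : (m : ℝ) ^ ((k : ℤ) + 1) = (m : ℝ) ^ (k + 1) := by norm_cast
    rw [this, zpow_natCast, one_pow, inv_pow]
    push_cast
    ring
  | @add d f g _ _ hf hg =>
    refine fun p => .congr (fun n _ => ?_) ((hf p).add (hg p))
    simp only [Pi.add_apply, mul_add, psum_add]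
  | @smul d f c _ hf =>
    refine fun p => .congr (fun n _ => ?_) ((hf p).smul c)
    simp only [Pi.smul_apply, smul_eq_mul, mul_left_comm _ (c : ℝ), psum_mul_left]

namespace LaurentSum

lemma psum {f : ℕ → ℝ} (hf : LaurentSum f) : LaurentSum (psum f) := by
  induction hf with
  | mk p hg => exact psum_zpow_mul hg hg.laurentSum_psum p
  | @add f g _ _ hf hg =>
    exact .congr (fun n _ => (psum_add f g n).symm) (hf.add hg)
  | congr h _ ih => exact .congr (fun n _ => psum_congr fun m hm _ => h m hm) ih

lemma mul_of_mem_towerAlg {q : Tuple 0 × ℕ → ℝ} (hq : q ∈ towerAlg 0) :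
    ∀ {f : ℕ → ℝ}, LaurentSum f → LaurentSum fun n => q ((), n) * f n := by
  induction hq using Algebra.adjoin_induction with
  | mem q hq =>
    intro f hf
    obtain (rfl | rfl) | hq := hq
    · exact .congr (fun n _ => by simp) (hf.zpow_mul 1)
    · exact .congr (fun n _ => by simp) (hf.zpow_mul (-1))
    · refine .congr (fun n hn => ?_) .zero
      rw [hq ((), n) hn]
      simp
  | algebraMap c => exact fun hf => hf.smul c
  | add q q' _ _ h h' =>
    exact fun hf => .congr (fun n _ => (add_mul _ _ _).symm) ((h hf).add (h' hf))
  | mul q q' _ _ h h' =>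
    exact fun hf => .congr (fun n _ => (mul_assoc _ _ _).symm) (h (h' hf))

lemma of_mem_sumAlg {f : Tuple 0 × ℕ → ℝ} (hf : f ∈ sumAlg (towerAlg 0)) :
    LaurentSum fun n => f ((), n) := by
  change SumClosure _ f at hf
  induction hf with
  | base hq =>
    exact .congr (fun n _ => mul_one _) (mul_of_mem_towerAlg hq (.of_harmonicSum (.one 0)))
  | add _ _ hf hg => exact hf.add hg
  | mul hq _ hf => exact mul_of_mem_towerAlg hq hf
  | sum _ hf => exact hf.psum

variable {S : Subalgebra ℚ ℝ}

lemma exists_expands (hS : ∀ d f, HarmonicSum d f → Expands S f) {f : ℕ → ℝ}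
    (hf : LaurentSum f) :
    ∃ (P : ℕ) (h : ℕ → ℝ), Expands S h ∧ ∀ n, 0 < n → f n = (n : ℝ) ^ P * h n := by
  have hx : ∀ p : ℕ, Expands S fun n => ((n : ℝ)⁻¹) ^ p := fun p =>
    .of_mem (pow_mem (logAlg.recip S).2 p)
  induction hf with
  | mk p hg =>
    obtain ⟨p, rfl | rfl⟩ := p.eq_nat_or_neg
    · exact ⟨p, _, hS _ _ hg, fun n _ => by simp⟩
    · exact ⟨0, _, (hx p).mul (hS _ _ hg), fun n _ => by simp⟩
  | add _ _ hf hg =>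
    obtain ⟨P, h, hh, hf⟩ := hf
    obtain ⟨P', h', hh', hg⟩ := hg
    refine ⟨P + P', _, ((hx P').mul hh).add ((hx P).mul hh'), fun n hn => ?_⟩
    have : (n : ℝ) ≠ 0 := by positivity
    simp only [Pi.add_apply, Pi.mul_apply, hf n hn, hg n hn, inv_pow]
    field_simp
    ring
  | congr h _ ih =>
    obtain ⟨P, u, hu, hf⟩ := ih
    exact ⟨P, u, hu, fun n hn => by rw [← h n hn, hf n hn]⟩

lemma mem_of_tendsto (hS : ∀ d f, HarmonicSum d f → Expands S f) {f : ℕ → ℝ}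
    (hf : LaurentSum f) {L : ℝ} (hL : Tendsto f atTop (𝓝 L)) : L ∈ S := by
  obtain ⟨P, h, hh, hf⟩ := exists_expands hS hf
  obtain ⟨e, he, h₁⟩ := hh (P + 1)
  refine logAlg.mem_of_tendsto P ⟨e, he⟩ ?_
  have h₂ : (fun n : ℕ => (n : ℝ) ^ P * (h n - e n)) =O[atTop] fun n : ℕ => (n : ℝ)⁻¹ := by
    refine ((isBigO_refl (fun n : ℕ => (n : ℝ) ^ P) _).mul h₁).congr' .rfl ?_
    filter_upwards [eventually_gt_atTop 0] with n hn
    have : (n : ℝ) ≠ 0 := by positivity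
    rw [pow_succ, ← mul_assoc, ← mul_pow, mul_inv_cancel₀ this, one_pow, one_mul]
  have h₃ := hL.sub (h₂.trans_tendsto tendsto_inv_atTop_nhds_zero_nat)
  rw [sub_zero] at h₃
  refine h₃.congr' ?_
  filter_upwards [eventually_gt_atTop 0] with n hn
  rw [hf n hn]
  ring

end LaurentSum

end Laurent

section Limits

open Filter Topology Asymptotics

/-- The strictly increasing sequences of `r` integers in `[1, n)`. -/
def incTuples (r n : ℕ) : Finset (Fin r → ℕ) :=
  {v ∈ Fintype.piFinset fun _ => Ico 1 n | StrictMono v}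

lemma mem_incTuples {r n : ℕ} {v : Fin r → ℕ} :
    v ∈ incTuples r n ↔ (∀ i, 0 < v i ∧ v i < n) ∧ StrictMono v := by
  simp [incTuples, Nat.succ_le_iff]

lemma sum_incTuples_zero (n : ℕ) (F : (Fin 0 → ℕ) → ℝ) :
    ∑ v ∈ incTuples 0 n, F v = F Fin.elim0 := by
  have : incTuples 0 n = {Fin.elim0} := by
    ext v
    simp [mem_incTuples, Subsingleton.elim v Fin.elim0, Subsingleton.strictMono]
  rw [this, Finset.sum_singleton]

lemma strictMono_snoc {r m : ℕ} {v : Fin r → ℕ} (hv : StrictMono v) (hm : ∀ i, v i < m) :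
    StrictMono (Fin.snoc v m : Fin (r + 1) → ℕ) := by
  intro i j hij
  induction j using Fin.lastCases with
  | last =>
    induction i using Fin.lastCases with
    | last => exact absurd hij (lt_irrefl _)
    | cast i => simpa using hm i
  | cast j =>
    induction i using Fin.lastCases with
    | last => exact absurd hij (not_lt.2 (Fin.castSucc_lt_last j).le)
    | cast i => simpa using hv (Fin.castSucc_lt_castSucc_iff.1 hij)

lemma sum_incTuples_succ (r n : ℕ) (F : (Fin (r + 1) → ℕ) → ℝ) :
    ∑ v ∈ incTuples (r + 1) n, F v =
      psum (fun m => ∑ v ∈ incTuples r m, F (Fin.snoc v m)) n := by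
  rw [psum, Finset.sum_sigma']
  refine Finset.sum_bij' (fun v _ => ⟨v (Fin.last r), Fin.init v⟩) (fun p _ => Fin.snoc p.2 p.1)
    (fun v hv => ?_) (fun p hp => ?_) (fun v _ => by simp) (fun p _ => by simp) (fun v _ => by simp)
  · obtain ⟨h, hv⟩ := mem_incTuples.1 hv
    refine Finset.mem_sigma.2 ⟨Finset.mem_Ico.2 (h _), mem_incTuples.2 ⟨fun i => ⟨(h _).1, ?_⟩, ?_⟩⟩
    · exact hv (Fin.castSucc_lt_last i)
    · exact hv.comp Fin.strictMono_castSucc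
  · obtain ⟨hm, hv⟩ := Finset.mem_sigma.1 hp
    obtain ⟨h, hv⟩ := mem_incTuples.1 hv
    obtain ⟨hm₁, hm₂⟩ := Finset.mem_Ico.1 hm
    refine mem_incTuples.2 ⟨fun i => ?_, strictMono_snoc hv fun i => (h i).2⟩
    induction i using Fin.lastCases with
    | last => simpa using ⟨hm₁, hm₂⟩
    | cast i => simpa using ⟨(h i).1, (h i).2.trans hm₂⟩

/-- The multiple harmonic sum with exponents `k`. -/
noncomputable def mhs {r : ℕ} (k : Fin r → ℕ) (n : ℕ) : ℝ :=
  ∑ v ∈ incTuples r n, ∏ i, (1 : ℝ) / (v i : ℝ) ^ (k i)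

lemma mhs_zero (k : Fin 0 → ℕ) : mhs k = 1 := by
  funext n
  rw [mhs, sum_incTuples_zero]
  simp

lemma zsum_mhs {r : ℕ} (k : Fin r → ℕ) (a : ℕ) :
    zsum a (mhs k) = mhs (Fin.snoc k (a + 1) : Fin (r + 1) → ℕ) := by
  funext n
  rw [zsum_apply, mhs, sum_incTuples_succ]
  refine psum_congr fun m _ _ => ?_
  rw [mhs, Finset.mul_sum]
  refine Finset.sum_congr rfl fun v _ => ?_
  rw [Fin.prod_univ_castSucc]
  simp [mul_comm]

lemma exists_foldr_zsum_eq (l : List ℕ) :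
    ∃ (r : ℕ) (k : Fin r → ℕ), (∀ i, 1 ≤ k i) ∧ l.foldr (fun a f => zsum a f) 1 = mhs k := by
  induction l with
  | nil => exact ⟨0, Fin.elim0, fun i => i.elim0, (mhs_zero _).symm⟩
  | cons a l ih =>
    obtain ⟨r, k, hk, h⟩ := ih
    refine ⟨r + 1, Fin.snoc k (a + 1), fun i => ?_, by rw [List.foldr_cons, h, zsum_mhs]⟩
    induction i using Fin.lastCases with
    | last => simp
    | cast i => simpa using hk i

lemma harm_nonneg (n : ℕ) : 0 ≤ harm n := psum_nonneg fun (_ : ℕ) _ _ => by positivity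

lemma harm_mono : Monotone harm := fun a b hab =>
  Finset.sum_le_sum_of_subset_of_nonneg (Finset.Ico_subset_Ico_right hab)
    fun _ _ _ => by positivity

lemma foldr_zsum_nonneg_and_le (l : List ℕ) (n : ℕ) :
    0 ≤ l.foldr (fun a f => zsum a f) 1 n ∧
      l.foldr (fun a f => zsum a f) 1 n ≤ harm n ^ l.length := by
  induction l generalizing n with
  | nil => simp
  | cons a l ih =>
    rw [List.foldr_cons, zsum_apply, List.length_cons]
    refine ⟨psum_nonneg fun (m : ℕ) _ _ => mul_nonneg (by positivity) (ih m).1, ?_⟩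
    rw [pow_succ, harm, ← psum_mul_left]
    refine psum_mono fun m hm hmn => ?_
    rw [mul_comm]
    have h₁ : (m : ℝ)⁻¹ ^ (a + 1) ≤ (m : ℝ)⁻¹ := by
      simpa using pow_le_pow_of_le_one (a := (m : ℝ)⁻¹) (by positivity) (Nat.cast_inv_le_one m)
        (show 1 ≤ a + 1 by omega)
    exact mul_le_mul ((ih m).2.trans (pow_le_pow_left₀ (harm_nonneg m) (harm_mono hmn.le) _)) h₁
      (by positivity) (pow_nonneg (harm_nonneg n) _)

lemma subPow_foldr_zsum (l : List ℕ) : SubPow (l.foldr (fun a f => zsum a f) 1) := by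
  intro ε hε
  refine IsBigO.trans (IsBigO.of_bound 1 (.of_forall fun n => ?_))
    (subPow_of_mem_logAlg (pow_mem (logAlg.har ⊥).2 l.length) ε hε)
  obtain ⟨h₁, h₂⟩ := foldr_zsum_nonneg_and_le l n
  rw [one_mul, Real.norm_of_nonneg h₁]
  exact h₂.trans (le_abs_self _)

lemma SubPow.exists_tendsto_zsum {f : ℕ → ℝ} (hf : SubPow f) (a : ℕ) :
    ∃ c, Tendsto (zsum (a + 1) f) atTop (𝓝 c) := by
  have hs : Summable fun m : ℕ => (m : ℝ)⁻¹ ^ (a + 1 + 1) * f m := by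
    refine summable_of_isBigO_nat (g := fun n : ℕ => (n : ℝ) ^ (-(3 / 2) : ℝ))
      (Real.summable_nat_rpow.2 (by norm_num)) ?_
    have h₁ : (fun n : ℕ => (n : ℝ)⁻¹ ^ (a + 1 + 1)) =O[atTop] fun n : ℕ => (n : ℝ) ^ (-2 : ℝ) := by
      refine IsBigO.of_bound 1 (.of_forall fun n => ?_)
      rw [one_mul, Real.norm_of_nonneg (by positivity), Real.norm_of_nonneg (by positivity),
        Real.rpow_neg (by positivity), Real.rpow_two, ← inv_pow]
      exact pow_le_pow_of_le_one (by positivity) (Nat.cast_inv_le_one n) (by omega)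
    refine (h₁.mul (hf (1 / 2) (by norm_num))).congr' .rfl ?_
    filter_upwards [eventually_gt_atTop 0] with n hn
    have hn' : (0 : ℝ) < n := by exact_mod_cast hn
    rw [← Real.rpow_add hn']
    norm_num
  refine ⟨_, hs.hasSum.tendsto_sum_nat.congr' ?_⟩
  filter_upwards [eventually_gt_atTop 0] with n hn
  rw [zsum_apply, psum, Finset.range_eq_Ico, Finset.sum_eq_sum_Ico_succ_bot hn]
  simp

lemma mzv_eq_of_tendsto {r : ℕ} {k : Fin (r + 1) → ℕ} {c : ℝ}
    (h : Tendsto (mhs k) atTop (𝓝 c)) : mzv k = c := by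
  classical
  have hmono : Monotone (mhs k) := by
    intro a b hab
    refine Finset.sum_le_sum_of_subset_of_nonneg (fun v hv => ?_) fun _ _ _ => by positivity
    obtain ⟨h₁, h₂⟩ := mem_incTuples.1 hv
    exact mem_incTuples.2 ⟨fun i => ⟨(h₁ i).1, (h₁ i).2.trans_le hab⟩, h₂⟩
  refine (hasSum_of_isLUB_of_nonneg c (fun v => by positivity) ⟨?_, ?_⟩).tsum_eq
  · rintro _ ⟨u, rfl⟩
    refine le_trans ?_ (hmono.ge_of_tendsto h (u.sup (fun v => v.1 (Fin.last r)) + 1))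
    rw [mhs, ← Finset.sum_subtype_of_mem (p := fun v => (∀ i, 0 < v i) ∧ StrictMono v) _
      fun v hv => ⟨fun i => ((mem_incTuples.1 hv).1 i).1, (mem_incTuples.1 hv).2⟩]
    refine Finset.sum_le_sum_of_subset_of_nonneg (fun v hv => ?_) fun _ _ _ => by positivity
    refine Finset.mem_subtype.2 (mem_incTuples.2 ⟨fun i => ⟨v.2.1 i, ?_⟩, v.2.2⟩)
    refine Nat.lt_succ_of_le ((v.2.2.monotone (Fin.le_last i)).trans ?_)
    exact Finset.le_sup (f := fun v : {v : Fin (r + 1) → ℕ // (∀ i, 0 < v i) ∧ StrictMono v} =>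
      v.1 (Fin.last r)) hv
  · intro b hb
    refine le_of_tendsto' h fun n => ?_
    rw [mhs, ← Finset.sum_subtype_of_mem (p := fun v => (∀ i, 0 < v i) ∧ StrictMono v) _
      fun v hv => ⟨fun i => ((mem_incTuples.1 hv).1 i).1, (mem_incTuples.1 hv).2⟩]
    exact hb ⟨_, rfl⟩

lemma tendsto_zsum_foldr (a : ℕ) (l : List ℕ) :
    ∃ c ∈ Algebra.adjoin ℚ {x : ℝ | IsMZV x},
      Tendsto (zsum (a + 1) (l.foldr (fun a f => zsum a f) 1)) atTop (𝓝 c) := by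
  obtain ⟨c, hc⟩ := (subPow_foldr_zsum l).exists_tendsto_zsum a
  refine ⟨c, Algebra.subset_adjoin ?_, hc⟩
  obtain ⟨r, k, hk, h⟩ := exists_foldr_zsum_eq l
  rw [h, zsum_mhs] at hc
  refine ⟨r, _, fun i => ?_, ?_, (mzv_eq_of_tendsto hc).symm⟩
  · induction i using Fin.lastCases with
    | last => simp
    | cast i => simpa using hk i
  · simp

lemma HarmonicSum.exists_tendsto_foldr {d : ℕ} {f : ℕ → ℝ} (hf : HarmonicSum d f) (a : ℕ) :
    ∀ l : List ℕ, ∃ c ∈ Algebra.adjoin ℚ {x : ℝ | IsMZV x},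
      Tendsto (zsum (a + 1) (l.foldr (fun a f => zsum a f) f)) atTop (𝓝 c) := by
  induction hf with
  | one d => exact tendsto_zsum_foldr a
  | sum k _ ih => exact fun l => by simpa using ih (l ++ [k])
  | @add _ f g _ _ hf hg =>
    intro l
    obtain ⟨c, hc, h⟩ := hf l
    obtain ⟨c', hc', h'⟩ := hg l
    refine ⟨c + c', add_mem hc hc', ?_⟩
    have : l.foldr (fun a f => zsum a f) (f + g) =
        l.foldr (fun a f => zsum a f) f + l.foldr (fun a f => zsum a f) g := by
      clear h h'
      induction l with
      | nil => rfl
      | cons b l ih => simp only [List.foldr_cons, ih, map_add]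
    rw [this, map_add]
    exact h.add h'
  | @smul _ f q _ hf =>
    intro l
    obtain ⟨c, hc, h⟩ := hf l
    refine ⟨q * c, mul_mem (Subalgebra.algebraMap_mem _ q) hc, ?_⟩
    have : l.foldr (fun a f => zsum a f) ((q : ℝ) • f) =
        (q : ℝ) • l.foldr (fun a f => zsum a f) f := by
      clear h
      induction l with
      | nil => rfl
      | cons b l ih => simp only [List.foldr_cons, ih, map_smul]
    rw [this, map_smul]
    exact h.const_mul _

theorem mem_adjoin_of_tendsto {g : Tuple 0 × ℕ → ℝ} (hg : g ∈ sumAlg (towerAlg 0)) {L : ℝ}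
    (hL : Tendsto (fun N => g ((), N)) atTop (𝓝 L)) :
    L ∈ Algebra.adjoin ℚ {x : ℝ | IsMZV x} :=
  (LaurentSum.of_mem_sumAlg hg).mem_of_tendsto
    (fun _ _ h => h.expands fun _ _ k h => h.exists_tendsto_foldr k []) hL

end Limits

/-- A convergent conical sum has no zero column. -/
lemma exists_eq_one_of_summable {r n : ℕ} (a : Fin r → Fin n → ℕ)
    (h01 : ∀ i j, a i j = 0 ∨ a i j = 1) (hrow : ∀ i, ∃ j, a i j = 1)
    (hsum : Summable (fun x : {x : Fin n → ℕ // ∀ j, 0 < x j} =>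
      ∏ i, (1 : ℝ) / ∑ j, (a i j : ℝ) * (x.1 j : ℝ))) (j₀ : Fin n) : ∃ i, a i j₀ = 1 := by
  by_contra! h
  have h0 : ∀ i, a i j₀ = 0 := fun i => (h01 i j₀).resolve_right (h i)
  let f : ℕ → {x : Fin n → ℕ // ∀ j, 0 < x j} := fun m =>
    ⟨fun j => if j = j₀ then m + 1 else 1, fun j => by dsimp only; split_ifs <;> omega⟩
  have hf : Function.Injective f := fun m m' hm => by
    have := congrFun (congrArg Subtype.val hm) j₀
    simpa [f] using this
  have hs := hsum.comp_injective hf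
  have hc : ∀ m, ∏ i, (1 : ℝ) / ∑ j, (a i j : ℝ) * ((f m).1 j : ℝ) =
      ∏ i, (1 : ℝ) / ∑ j, (a i j : ℝ) := fun m => by
    refine prod_congr rfl fun i _ => ?_
    congr 1
    refine sum_congr rfl fun j _ => ?_
    by_cases hj : j = j₀
    · simp [hj, h0]
    · simp [f, hj]
  have hs' : Summable fun _ : ℕ => ∏ i, (1 : ℝ) / ∑ j, (a i j : ℝ) := hs.congr hc
  have h0' := (summable_const_iff _).1 hs'
  have hpos : 0 < ∏ i, (1 : ℝ) / ∑ j, (a i j : ℝ) := by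
    refine prod_pos fun i _ => one_div_pos.2 ?_
    obtain ⟨j, hj⟩ := hrow i
    exact sum_pos' (fun _ _ => Nat.cast_nonneg _) ⟨j, mem_univ _, by simp [hj]⟩
  exact hpos.ne' h0'

/-- If a `{0,1}`-matrix `A` with no zero row has, after a permutation `σ` of
its rows, consecutive ones in every column, and the conical sum
`ζ(A) = Σ_{x ∈ (ℤ_{>0})ⁿ} 1/(l₁(x)⋯l_r(x))` converges, then `ζ(A)` lies in the
`ℚ`-subalgebra `𝒜` of `ℝ` generated by the multiple zeta values. -/
theorem zetaA_consecutive_ones_mem_mzv_algebra (r n : ℕ) (hr : 0 < r) (hn : 0 < n)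
    (a : Fin r → Fin n → ℕ)
    (h01 : ∀ i j, a i j = 0 ∨ a i j = 1)
    (hrow : ∀ i, ∃ j, a i j = 1)
    (σ : Equiv.Perm (Fin r))
    (hcons : ∀ j : Fin n, ∀ i₁ i₂ i₃ : Fin r, i₁ ≤ i₂ → i₂ ≤ i₃ →
      a (σ i₁) j = 1 → a (σ i₃) j = 1 → a (σ i₂) j = 1)
    (hsum : Summable (fun x : {x : Fin n → ℕ // ∀ j, 0 < x j} =>
      ∏ i, (1 : ℝ) / ∑ j, (a i j : ℝ) * (x.1 j : ℝ))) :
    (∑' x : {x : Fin n → ℕ // ∀ j, 0 < x j},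
        ∏ i, (1 : ℝ) / ∑ j, (a i j : ℝ) * (x.1 j : ℝ)) ∈
      Algebra.adjoin ℚ {x : ℝ | IsMZV x} := by
  have hcol := exists_eq_one_of_summable a h01 hrow hsum
  have hmin : ∀ j, ∃ i, a (σ i) j = 1 ∧ ∀ i', a (σ i') j = 1 → i ≤ i' := fun j => by
    obtain ⟨i, hi⟩ := hcol j
    obtain ⟨m, hm, h⟩ := exists_min_image (univ.filter fun i => a (σ i) j = 1) id
      ⟨σ.symm i, by simpa using hi⟩
    exact ⟨m, by simpa using hm, by simpa using h⟩
  have hmax : ∀ j, ∃ i, a (σ i) j = 1 ∧ ∀ i', a (σ i') j = 1 → i' ≤ i := fun j => by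
    obtain ⟨i, hi⟩ := hcol j
    obtain ⟨m, hm, h⟩ := exists_max_image (univ.filter fun i => a (σ i) j = 1) id
      ⟨σ.symm i, by simpa using hi⟩
    exact ⟨m, by simpa using hm, by simpa using h⟩
  choose lo hlo hlo' using hmin
  choose hi hhi hhi' using hmax
  let e : (Fin n → ℕ) ≃ {x : Fin n → ℕ // ∀ j, 0 < x j} :=
    { toFun := fun y => ⟨fun j => y j + 1, fun j => Nat.succ_pos _⟩
      invFun := fun x j => x.1 j - 1
      left_inv := fun y => by funext j; simp
      right_inv := fun x => Subtype.ext (by funext j; exact Nat.sub_add_cancel (x.2 j)) }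
  have he : ∀ y, ∏ i, (1 : ℝ) / ∑ j, (a i j : ℝ) * ((e y).1 j : ℝ) =
      ∏ i, (1 : ℝ) / ∑ j, (a (σ i) j : ℝ) * ((y j : ℝ) + 1) := fun y => by
    rw [← Equiv.prod_comp σ]
    simp [e]
  have hsum' := ((e.summable_iff).2 hsum).congr he
  rw [← e.tsum_eq]
  simp only [he]
  have hA : ∀ (i : Fin r) j, a (σ i) j =
      if (lo j : ℕ) ≤ i ∧ (i : ℕ) < (hi j : ℕ) + 1 then 1 else 0 := fun i j => by
    by_cases h : a (σ i) j = 1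
    · rw [h, if_pos ⟨hlo' j i h, Nat.lt_succ_of_le (hhi' j i h)⟩]
    · rw [(h01 _ _).resolve_right h, if_neg]
      exact fun h' => h (hcons j (lo j) i (hi j) h'.1 (Nat.lt_succ_iff.1 h'.2) (hlo j) (hhi j))
  obtain ⟨g, hg, hlim⟩ := exists_mem_sumAlg_tendsto (fun i j => a (σ i) j) (fun i => hrow (σ i))
    (fun j => (lo j : ℕ)) (fun j => (hi j : ℕ) + 1) (fun j => Nat.lt_succ_of_le (hlo' j _ (hhi j)))
    (fun j => (hi j).2) hA hsum'
  exact mem_adjoin_of_tendsto hg hlim
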